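/- arXiv:2107.12412 — 10 statements merged into one kernel-verified Lean document; each statement's English description precedes it below -/
import Mathlib

section
/- Let z : ℝ → ℝ ∪ {+∞} be an energy satisfying (z1)–(z3) and let b ∈ ℝ with 0 < z*(b) < +∞. Then there exists b₀ < b such that every c ∈ ∂z*(b) satisfies c ≥ z*(b)/(2(b − b₀)) > 0. Consequently z*(b′) < z*(b) for every b′ < b; in particular, z* restricted to the set {b ∈ ℝ : 0 < z*(b) < +∞} is injective. -/
open MeasureTheory Filter Set Topology

noncomputable section

/-- Convexity for `EReal`-valued functions on `ℝ`. -/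
def ConvexE (f : ℝ → EReal) : Prop :=
  ∀ x y t : ℝ, 0 < t → t < 1 →
    f (t * x + (1 - t) * y) ≤ (t : EReal) * f x + ((1 - t) : EReal) * f y

/-- Subdifferential of an `EReal`-valued function at a point. -/
def subdiff (f : ℝ → EReal) (a : ℝ) : Set ℝ :=
  {b : ℝ | ∀ x : ℝ, f a + ((b * (x - a) : ℝ) : EReal) ≤ f x}

/-- Convex (Legendre) conjugate. -/
noncomputable def conj (f : ℝ → EReal) (b : ℝ) : EReal :=
  ⨆ a : ℝ, ((a * b : ℝ) : EReal) - f a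

/-- An energy satisfying assumptions (z1)-(z3). -/
structure IsEnergy (z : ℝ → EReal) : Prop where
  proper : ∃ a : ℝ, z a ≠ ⊤
  ne_bot : ∀ a : ℝ, z a ≠ ⊥
  lsc : LowerSemicontinuous z
  convex : ConvexE z
  top_of_neg : ∀ a : ℝ, a < 0 → z a = ⊤
  zero : z 0 = 0
  slope : ∃ a : ℝ, 0 < a ∧ ∃ L : ℝ, subdiff z a = {L} ∧ ∀ c ∈ subdiff z 0, c < L

theorem conj_le_aux (z : ℝ → EReal) (hz : IsEnergy z) (b M : ℝ)
    (h : ∀ a r : ℝ, 0 ≤ a → z a = (r : EReal) → a * b - r ≤ M) : conj z b ≤ (M : EReal) := by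
  unfold conj
  refine iSup_le fun a => ?_
  by_cases ht : z a = ⊤
  · rw [ht]; simp
  · have h0 : 0 ≤ a := by
      by_contra hn
      exact ht (hz.top_of_neg a (not_le.mp hn))
    have e := (EReal.coe_toReal ht (hz.ne_bot a)).symm
    have := h a _ h0 e
    rw [e]
    exact_mod_cast this

theorem le_conj_aux (z : ℝ → EReal) (b v a r : ℝ)
    (hv : conj z b = (v : EReal)) (e : z a = (r : EReal)) : a * b - r ≤ v := by
  have h : ((a * b : ℝ) : EReal) - z a ≤ conj z b :=
    le_iSup (fun a : ℝ => ((a * b : ℝ) : EReal) - z a) a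
  rw [hv, e] at h
  exact_mod_cast h

theorem near_aux (z : ℝ → EReal) (hz : IsEnergy z) (ε : ℝ) (hε : 0 < ε) :
    ∃ δ : ℝ, 0 < δ ∧ ∀ a r : ℝ, 0 ≤ a → a < δ → z a = (r : EReal) → -ε < r := by
  have h := hz.lsc 0 ((-ε : ℝ) : EReal) (by
    show ((-ε : ℝ) : EReal) < z 0
    rw [hz.zero]; exact_mod_cast neg_neg_of_pos hε)
  obtain ⟨δ, hδ, H⟩ := Metric.eventually_nhds_iff.mp h
  refine ⟨δ, hδ, fun a r h0 h1 e => ?_⟩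
  have : ((-ε : ℝ) : EReal) < z a := @H a (by simpa [abs_of_nonneg h0] using h1)
  rw [e] at this
  exact_mod_cast this

/-- Where `0 < z*(b) < ∞`, the conjugate is strictly increasing; quantitatively every
subgradient of `z*` at `b` is at least `z*(b) / (2 (b - b₀)) > 0` for a suitable `b₀ < b`,
and `z*` is injective on the set where it is positive and finite. -/
theorem statement2 (z : ℝ → EReal) (hz : IsEnergy z) :
    (∀ b : ℝ, 0 < conj z b → conj z b ≠ ⊤ →
      (∃ b₀ : ℝ, b₀ < b ∧ 0 < (conj z b).toReal / (2 * (b - b₀)) ∧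
        ∀ c ∈ subdiff (conj z) b, (conj z b).toReal / (2 * (b - b₀)) ≤ c) ∧
      (∀ b' : ℝ, b' < b → conj z b' < conj z b)) ∧
    Set.InjOn (conj z) {b : ℝ | 0 < conj z b ∧ conj z b ≠ ⊤} := by
  have key : ∀ b : ℝ, 0 < conj z b → conj z b ≠ ⊤ →
      (∃ b₀ : ℝ, b₀ < b ∧ 0 < (conj z b).toReal / (2 * (b - b₀)) ∧
        ∀ c ∈ subdiff (conj z) b, (conj z b).toReal / (2 * (b - b₀)) ≤ c) ∧
      (∀ b' : ℝ, b' < b → conj z b' < conj z b) := by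
    intro b hpos htop
    obtain ⟨v, hv⟩ : ∃ v : ℝ, conj z b = (v : EReal) :=
      ⟨_, (EReal.coe_toReal htop (ne_bot_of_gt hpos)).symm⟩
    have hv0 : 0 < v := by rw [hv] at hpos; exact_mod_cast hpos
    obtain ⟨δ, hδ, H⟩ := near_aux z hz (v / 4) (by positivity)
    rw [hv, EReal.toReal_coe]
    constructor
    · have hq : 0 < v / δ := by positivity
      have hqm : δ * (v / δ) = v := by field_simp
      have hb := neg_abs_le b
      have hb2 := le_abs_self b
      have hb3 := abs_nonneg b
      refine ⟨b - (|b| + v / δ), by linarith, div_pos hv0 (by linarith), ?_⟩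
      intro c hc
      have h1 := hc (b - (|b| + v / δ))
      have h2 : conj z (b - (|b| + v / δ)) ≤ ((v / 2 : ℝ) : EReal) := by
        apply conj_le_aux z hz
        intro a r h0 e
        by_cases ha : a < δ
        · have := H a r h0 ha e
          have : a * (b - (|b| + v / δ)) ≤ 0 :=
            mul_nonpos_of_nonneg_of_nonpos h0 (by linarith)
          linarith
        · have h3 := le_conj_aux z b v a r hv e
          have h4 : δ * (v / δ) ≤ a * (|b| + v / δ) :=
            mul_le_mul (not_lt.mp ha) (by linarith) hq.le h0
          linarith
      have h3 := h1.trans h2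
      rw [hv] at h3
      have h4 : v + c * (b - (|b| + v / δ) - b) ≤ v / 2 := by exact_mod_cast h3
      rw [div_le_iff₀ (by linarith)]
      linarith
    · intro b' hb'
      have hm : 0 < |b'| + 1 := by positivity
      set η := min δ (v / 4 / (|b'| + 1)) with hη
      have hη0 : 0 < η := lt_min hδ (by positivity)
      have hle : conj z b' ≤ ((max (v / 2) (v - η * (b - b')) : ℝ) : EReal) := by
        apply conj_le_aux z hz
        intro a r h0 e
        by_cases ha : a < η
        · apply le_max_of_le_left
          have h1 := H a r h0 (ha.trans_le (min_le_left _ _)) e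
          have h2 : a < v / 4 / (|b'| + 1) := ha.trans_le (min_le_right _ _)
          rw [lt_div_iff₀ hm] at h2
          have h3 : a * b' ≤ a * (|b'| + 1) :=
            mul_le_mul_of_nonneg_left (by linarith [le_abs_self b']) h0
          linarith
        · apply le_max_of_le_right
          have h3 := le_conj_aux z b v a r hv e
          have h4 : η * (b - b') ≤ a * (b - b') :=
            mul_le_mul_of_nonneg_right (not_lt.mp ha) (by linarith)
          linarith
      refine hle.trans_lt ?_
      rw [EReal.coe_lt_coe_iff]
      have : 0 < η * (b - b') := mul_pos hη0 (by linarith)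
      exact max_lt (by linarith) (by linarith)
  refine ⟨key, ?_⟩
  intro x hx y hy hxy
  rcases lt_trichotomy x y with h | h | h
  · exact absurd hxy ((key y hy.1 hy.2).2 x h).ne
  · exact h
  · exact absurd hxy ((key x hx.1 hx.2).2 y h).ne'
end
end

section
/- Let z : ℝ → ℝ ∪ {+∞} be an energy satisfying (z1)–(z3). Suppose p₀ := sup{p ∈ ℝ : z*(p) = 0} is finite, and that there exists a₀ ∈ ∂z*(p₀) with a₀ > 0. Then for every p > p₀ with z*(p) ≠ +∞ one has z*(p) ≥ a₀·(p − p₀), and every c ∈ ∂z*(p) satisfies c ≥ a₀. Consequently, defining (z*)^{-1} on z*(ℝ) ∩ (0,∞) as the inverse of z* (which is injective there) and extending it by (z*)^{-1}(0) := p₀, one has |(z*)^{-1}(c) − (z*)^{-1}(c′)| ≤ |c − c′|/a₀ for all c, c′ ∈ (z*(ℝ) ∩ (0,∞)) ∪ {0}; in particular this extension is continuous at 0. -/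
open MeasureTheory Filter Set Topology

noncomputable section

theorem conj_le_iff_aux (z : ℝ → EReal) (hz : IsEnergy z) (b r : ℝ) :
    conj z b ≤ (r : EReal) ↔ ∀ a v : ℝ, z a = (v : EReal) → a * b - v ≤ r := by
  unfold conj
  rw [iSup_le_iff]
  constructor
  · intro h a v hv
    have := h a
    rw [hv] at this
    exact_mod_cast this
  · intro h a
    by_cases ht : z a = ⊤
    · rw [ht]; simp
    · have hv : z a = (((z a).toReal : ℝ) : EReal) :=
        (EReal.coe_toReal ht (hz.ne_bot a)).symm
      have := h a _ hv
      rw [hv]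
      exact_mod_cast this

theorem dom_nonneg_aux (z : ℝ → EReal) (hz : IsEnergy z) (a v : ℝ)
    (h : z a = (v : EReal)) : 0 ≤ a := by
  by_contra hc
  rw [hz.top_of_neg a (not_le.mp hc)] at h
  exact EReal.top_ne_coe v h

theorem conj_nonneg_aux (z : ℝ → EReal) (hz : IsEnergy z) (b : ℝ) : 0 ≤ conj z b := by
  have := le_iSup (fun a : ℝ => ((a * b : ℝ) : EReal) - z a) 0
  simpa [hz.zero, conj] using this

/-- If `p₀ = sup {p : z*(p) = 0}` is finite and some `a₀ ∈ ∂z*(p₀)` is positive, then `z*`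
grows at least linearly with slope `a₀` past `p₀`, all subgradients past `p₀` are at least
`a₀`, and the inverse of `z*` (defined on the positive finite values of `z*` and extended by
`(z*)⁻¹(0) := p₀`) is `1/a₀`-Lipschitz; in particular the extension is continuous at `0`. -/
theorem statement3 (z : ℝ → EReal) (hz : IsEnergy z)
    (hne : {p : ℝ | conj z p = 0}.Nonempty)
    (hbdd : BddAbove {p : ℝ | conj z p = 0})
    (p₀ : ℝ) (hp₀ : p₀ = sSup {p : ℝ | conj z p = 0})
    (a₀ : ℝ) (ha₀pos : 0 < a₀) (ha₀mem : a₀ ∈ subdiff (conj z) p₀) :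
    (∀ p : ℝ, p₀ < p → conj z p ≠ ⊤ →
      ((a₀ * (p - p₀) : ℝ) : EReal) ≤ conj z p ∧
      ∀ c ∈ subdiff (conj z) p, a₀ ≤ c) ∧
    (∀ g : ℝ → ℝ, g 0 = p₀ →
      (∀ b : ℝ, 0 < conj z b → conj z b ≠ ⊤ → g ((conj z b).toReal) = b) →
      ∀ c ∈ ({0} ∪ {c : ℝ | 0 < c ∧ ∃ b : ℝ, conj z b = (c : EReal)} : Set ℝ),
        ∀ c' ∈ ({0} ∪ {c : ℝ | 0 < c ∧ ∃ b : ℝ, conj z b = (c : EReal)} : Set ℝ),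
          |g c - g c'| ≤ |c - c'| / a₀) := by
  have h0 : conj z p₀ ≤ ((0 : ℝ) : EReal) := by
    rw [conj_le_iff_aux z hz]
    intro a v hv
    have hcl : p₀ ∈ closure {p : ℝ | conj z p = 0} := by
      rw [hp₀]; exact csSup_mem_closure hne hbdd
    have hsub : closure {p : ℝ | conj z p = 0} ⊆ {p : ℝ | a * p - v ≤ 0} := by
      apply closure_minimal
      · intro p hp
        have hp' : conj z p ≤ ((0 : ℝ) : EReal) := le_of_eq hp
        exact (conj_le_iff_aux z hz p 0).1 hp' a v hv
      · exact isClosed_le (by fun_prop) (by fun_prop)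
    exact hsub hcl
  have h0' : conj z p₀ = 0 := le_antisymm (by simpa using h0) (conj_nonneg_aux z hz p₀)
  have hlin : ∀ p : ℝ, ((a₀ * (p - p₀) : ℝ) : EReal) ≤ conj z p := by
    intro p
    have := ha₀mem p
    rwa [h0', zero_add] at this
  have key : ∀ p q c d : ℝ, p₀ ≤ p → p ≤ q → conj z p = (c : EReal) →
      conj z q = (d : EReal) → a₀ * (q - p) ≤ d - c := by
    intro p q c d hp hpq hc hd
    rcases eq_or_lt_of_le hpq with rfl | hlt
    · rw [hc] at hd
      have : c = d := by exact_mod_cast hd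
      simp [this]
    have hq : 0 < q - p₀ := by linarith
    have hdl : a₀ * (q - p₀) ≤ d := by
      have := hlin q
      rw [hd] at this
      exact_mod_cast this
    have hcd : c * (q - p₀) ≤ (p - p₀) * d := by
      rw [← le_div_iff₀ hq]
      have : conj z p ≤ (((p - p₀) * d / (q - p₀) : ℝ) : EReal) := by
        rw [conj_le_iff_aux z hz]
        intro a v hv
        have h1 := (conj_le_iff_aux z hz p₀ 0).1 h0 a v hv
        have h2 := (conj_le_iff_aux z hz q d).1 hd.le a v hv
        rw [le_div_iff₀ hq]
        nlinarith [mul_le_mul_of_nonneg_left h2 (sub_nonneg.2 hp),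
          mul_le_mul_of_nonneg_left h1 (sub_nonneg.2 hpq)]
      rw [hc] at this
      exact_mod_cast this
    have h3 := mul_le_mul_of_nonneg_left hdl (sub_nonneg.2 hpq)
    have h4 : (a₀ * (q - p)) * (q - p₀) ≤ (d - c) * (q - p₀) := by nlinarith
    exact le_of_mul_le_mul_right h4 hq
  refine ⟨fun p hp htop => ⟨hlin p, fun c hc => ?_⟩, ?_⟩
  · have hv : conj z p = (((conj z p).toReal : ℝ) : EReal) :=
      (EReal.coe_toReal htop (ne_bot_of_le_ne_bot (by simp) (conj_nonneg_aux z hz p))).symm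
    have h1 := hc p₀
    have h2 := hlin p
    rw [h0', hv] at h1
    rw [hv] at h2
    have h1' : (conj z p).toReal + c * (p₀ - p) ≤ 0 := by exact_mod_cast h1
    have h2' : a₀ * (p - p₀) ≤ (conj z p).toReal := by exact_mod_cast h2
    have h5 : a₀ * (p - p₀) ≤ c * (p - p₀) := by linarith
    exact le_of_mul_le_mul_right h5 (sub_pos.2 hp)
  · intro g hg0 hg
    have hD : ∀ c ∈ ({0} ∪ {c : ℝ | 0 < c ∧ ∃ b : ℝ, conj z b = (c : EReal)} : Set ℝ),
        p₀ ≤ g c ∧ conj z (g c) = (c : EReal) := by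
      rintro c (hc | ⟨hc, b, hb⟩)
      · have hc' : c = 0 := hc
        subst hc'
        rw [hg0]
        exact ⟨le_rfl, by simpa using h0'⟩
      · have h1 := hg b (by rw [hb]; exact_mod_cast hc) (by rw [hb]; exact EReal.coe_ne_top c)
        rw [hb, EReal.toReal_coe] at h1
        rw [h1]
        refine ⟨?_, hb⟩
        by_contra hlt
        have hlt' := not_le.mp hlt
        have : conj z b ≤ ((0 : ℝ) : EReal) := by
          rw [conj_le_iff_aux z hz]
          intro a v hv
          have h2 := (conj_le_iff_aux z hz p₀ 0).1 h0 a v hv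
          have h3 := mul_le_mul_of_nonneg_left hlt'.le (dom_nonneg_aux z hz a v hv)
          linarith
        rw [hb] at this
        have : c ≤ 0 := by exact_mod_cast this
        linarith
    intro c hc c' hc'
    obtain ⟨h1, h2⟩ := hD c hc
    obtain ⟨h3, h4⟩ := hD c' hc'
    rw [le_div_iff₀ ha₀pos]
    rcases le_total (g c) (g c') with h | h
    · have := key _ _ _ _ h1 h h2 h4
      rw [abs_sub_comm, abs_of_nonneg (sub_nonneg.2 h), abs_sub_comm c]
      linarith [le_abs_self (c' - c)]
    · have := key _ _ _ _ h3 h h4 h2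
      rw [abs_of_nonneg (sub_nonneg.2 h)]
      linarith [le_abs_self (c - c')]
end
end

section
/- Let z : ℝ → ℝ ∪ {+∞} be an energy satisfying (z1)–(z3) and define e from z as above. Then: e is proper, convex and lower semicontinuous; e(a) = +∞ if and only if z(a) = +∞ (in particular e(a) = +∞ for all a < 0); e(0) = 0; and e is nondecreasing on the set where it is finite, i.e., if a₀ ≤ a₁ and e(a₀), e(a₁) < +∞ then e(a₀) ≤ e(a₁). -/
open MeasureTheory Filter Set Topology

noncomputable section

/-- The transformed energy `e(a) = a z(a) - 2∫₀^a z(s) ds` (where `z(a)` is finite),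
`+∞` otherwise. -/
noncomputable def eFun (z : ℝ → EReal) (a : ℝ) : EReal :=
  if z a = ⊤ then ⊤
  else ((a * (z a).toReal - 2 * ∫ s in (0:ℝ)..a, (z s).toReal : ℝ) : EReal)

lemma aux_aff (a b A B : ℝ) : ∫ s in a..b, (A + B * (s - a)) = A * (b - a) + B * (b - a)^2 / 2 := by
  rw [intervalIntegral.integral_add (by simp) (Continuous.intervalIntegrable (by fun_prop) _ _)]
  simp
  ring

lemma aux_coe {z : ℝ → EReal} (hz : IsEnergy z) {a : ℝ} (h : z a ≠ ⊤) :
    ((z a).toReal : EReal) = z a := EReal.coe_toReal h (hz.ne_bot a)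

lemma aux_conv_ne_bot_le (f : ℝ → EReal) (hb : ∀ a, f a ≠ ⊥) (hc : ConvexOn ℝ {a | f a ≠ ⊤} (fun a => (f a).toReal)) :
    ConvexE f := by
  intro x y t h0 h1
  have e1 : ((1 : EReal) - (t : EReal)) = ((1 - t : ℝ) : EReal) := by norm_cast
  rw [e1]
  have nb : ∀ (s : ℝ) (a : ℝ), 0 < s → (s : EReal) * f a ≠ ⊥ := by
    intro s a hs
    by_cases h : f a = ⊤
    · rw [h, EReal.coe_mul_top_of_pos hs]; simp
    · rw [← EReal.coe_toReal h (hb a), ← EReal.coe_mul]; exact EReal.coe_ne_bot _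
  by_cases hx : f x = ⊤
  · rw [hx, EReal.coe_mul_top_of_pos h0, EReal.top_add_of_ne_bot (nb _ _ (by linarith))]
    exact le_top
  by_cases hy : f y = ⊤
  · rw [hy, EReal.coe_mul_top_of_pos (by linarith), EReal.add_top_of_ne_bot (nb _ _ h0)]
    exact le_top
  have hm := hc.1 hx hy h0.le (by linarith : 0 ≤ 1 - t) (by ring)
  have := hc.2 hx hy h0.le (by linarith : 0 ≤ 1 - t) (by ring)
  simp only [smul_eq_mul] at this hm
  rw [← EReal.coe_toReal hx (hb x), ← EReal.coe_toReal hy (hb y), ← EReal.coe_toReal hm (hb _)]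
  exact_mod_cast this

lemma aux_conv {z : ℝ → EReal} (hz : IsEnergy z) :
    ConvexOn ℝ {a | z a ≠ ⊤} (fun a => (z a).toReal) := by
  have key : ∀ x y t : ℝ, z x ≠ ⊤ → z y ≠ ⊤ → 0 < t → t < 1 →
      z (t * x + (1 - t) * y) ≤ ((t * (z x).toReal + (1 - t) * (z y).toReal : ℝ) : EReal) := by
    intro x y t hx hy h0 h1
    have := hz.convex x y t h0 h1
    rw [← aux_coe hz hx, ← aux_coe hz hy] at this
    exact_mod_cast this
  have hD : Convex ℝ {a | z a ≠ ⊤} := by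
    rw [convex_iff_forall_pos]
    intro x hx y hy a b ha hb hab
    obtain rfl : b = 1 - a := by linarith
    exact ((key x y a hx hy ha (by linarith)).trans_lt (EReal.coe_lt_top _)).ne
  rw [convexOn_iff_forall_pos]
  refine ⟨hD, ?_⟩
  intro x hx y hy a b ha hb hab
  have hm := hD hx hy ha.le hb.le hab
  obtain rfl : b = 1 - a := by linarith
  have := key x y a hx hy ha (by linarith)
  simp only [smul_eq_mul] at hm ⊢
  rw [← aux_coe hz hm] at this
  exact_mod_cast this

lemma aux_nonneg {z : ℝ → EReal} (hz : IsEnergy z) {a : ℝ} (h : z a ≠ ⊤) : 0 ≤ a := by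
  by_contra h'
  exact h (hz.top_of_neg a (by linarith))

lemma aux_mem {z : ℝ → EReal} (hz : IsEnergy z) {a s : ℝ} (h : z a ≠ ⊤) (h0 : 0 ≤ s) (h1 : s ≤ a) :
    z s ≠ ⊤ := by
  have h00 : z 0 ≠ ⊤ := by rw [hz.zero]; simp
  exact (aux_conv hz).1.ordConnected.out h00 h ⟨h0, h1⟩

/-- chord inequality -/
lemma aux_chord {z : ℝ → EReal} (hz : IsEnergy z) {x m y : ℝ} (hx : z x ≠ ⊤) (hy : z y ≠ ⊤)
    (h1 : x ≤ m) (h2 : m ≤ y) :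
    (y - x) * (z m).toReal ≤ (y - m) * (z x).toReal + (m - x) * (z y).toReal := by
  rcases eq_or_lt_of_le (h1.trans h2) with h | h
  · obtain rfl : x = m := by linarith
    subst h
    simp
  have hp : 0 < y - x := by linarith
  have := (aux_conv hz).2 hx hy
    (div_nonneg (by linarith) hp.le) (div_nonneg (by linarith) hp.le)
    (by field_simp; ring : (y - m) / (y - x) + (m - x) / (y - x) = 1)
  simp only [smul_eq_mul] at this
  have e : (y - m) / (y - x) * x + (m - x) / (y - x) * y = m := by field_simp; ring
  rw [e] at this
  have h3 := mul_le_mul_of_nonneg_left this hp.le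
  refine h3.trans (le_of_eq ?_)
  field_simp

lemma aux_lower {z : ℝ → EReal} (hz : IsEnergy z) {a : ℝ} (h : z a ≠ ⊤) :
    ∃ M : ℝ, 0 ≤ M ∧ ∀ s, 0 ≤ s → s ≤ a → -M ≤ (z s).toReal := by
  obtain ⟨m, hm, hmin⟩ := (hz.lsc.lowerSemicontinuousOn (Icc 0 a)).exists_isMinOn
    ⟨0, by simp [aux_nonneg hz h]⟩ isCompact_Icc
  refine ⟨|(z m).toReal|, abs_nonneg _, fun s h0 h1 => ?_⟩
  have : z m ≤ z s := hmin ⟨h0, h1⟩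
  have h2 := EReal.toReal_le_toReal this (hz.ne_bot _) (aux_mem hz h h0 h1)
  linarith [neg_abs_le (z m).toReal]

lemma aux_int {z : ℝ → EReal} (hz : IsEnergy z) {a : ℝ} (h : z a ≠ ⊤) :
    IntegrableOn (fun s => (z s).toReal) (Icc 0 a) := by
  obtain ⟨M, hM, hl⟩ := aux_lower hz h
  have h00 : z 0 ≠ ⊤ := by rw [hz.zero]; simp
  refine Measure.integrableOn_of_bounded (M := M + |(z a).toReal|) (by simp)
    (measurable_ereal_toReal.comp hz.lsc.measurable).aestronglyMeasurable ?_
  refine (ae_restrict_iff' measurableSet_Icc).2 (Eventually.of_forall ?_)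
  rintro s ⟨h0, h1⟩
  rw [Real.norm_eq_abs, abs_le]
  have := hl s h0 h1
  have c := aux_chord hz h00 h h0 h1
  simp only [hz.zero, EReal.toReal_zero, sub_zero, mul_zero, zero_add] at c
  refine ⟨by linarith [abs_nonneg (z a).toReal], ?_⟩
  rcases eq_or_lt_of_le (h0.trans h1) with h2 | h2
  · obtain rfl : s = 0 := by linarith
    simp [hz.zero]; positivity
  · have : a * (z s).toReal ≤ a * |(z a).toReal| := by
      refine c.trans ?_
      calc s * (z a).toReal ≤ s * |(z a).toReal| := by gcongr; exact le_abs_self _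
        _ ≤ _ := by gcongr
    have := le_of_mul_le_mul_left this h2
    linarith

lemma aux_ii {z : ℝ → EReal} (hz : IsEnergy z) {a x y : ℝ} (h : z a ≠ ⊤) (h0 : 0 ≤ x) (h1 : x ≤ y)
    (h2 : y ≤ a) : IntervalIntegrable (fun s => (z s).toReal) volume x y := by
  rw [intervalIntegrable_iff_integrableOn_Icc_of_le h1]
  exact (aux_int hz h).mono_set (Icc_subset_Icc h0 h2)

/-- the real-valued transformed energy -/
def eR (z : ℝ → EReal) (a : ℝ) : ℝ := a * (z a).toReal - 2 * ∫ s in (0:ℝ)..a, (z s).toReal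

lemma eR_sub {z : ℝ → EReal} (hz : IsEnergy z) {x y : ℝ} (hx : 0 ≤ x) (hy : z y ≠ ⊤) (h : x ≤ y) :
    eR z y - eR z x = y * (z y).toReal - x * (z x).toReal - 2 * ∫ s in x..y, (z s).toReal := by
  have := intervalIntegral.integral_add_adjacent_intervals (aux_ii hz hy le_rfl hx h)
    (aux_ii hz hy hx h le_rfl)
  unfold eR
  rw [← this]; ring

lemma eR_right {z : ℝ → EReal} (hz : IsEnergy z) {x y : ℝ} (hx : 0 ≤ x) (hy : z y ≠ ⊤) (h : x ≤ y) :
    x * (z y).toReal - y * (z x).toReal ≤ eR z y - eR z x := by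
  rw [eR_sub hz hx hy h]
  rcases eq_or_lt_of_le h with rfl | h
  · simp
  have hp : 0 < y - x := by linarith
  have := intervalIntegral.integral_mono_on h.le (aux_ii hz hy hx h.le le_rfl)
    (g := fun s => (z x).toReal + ((z y).toReal - (z x).toReal) / (y - x) * (s - x))
    (Continuous.intervalIntegrable (by fun_prop) _ _) (by
      rintro s ⟨h0, h1⟩
      have c := aux_chord hz (aux_mem hz hy hx h.le) hy h0 h1
      refine le_of_mul_le_mul_left (c.trans (le_of_eq ?_)) hp
      field_simp; ring)
  rw [aux_aff] at this
  have e : (z x).toReal * (y - x) + ((z y).toReal - (z x).toReal) / (y - x) * (y - x)^2 / 2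
    = (y - x) * ((z x).toReal + (z y).toReal) / 2 := by field_simp; ring
  rw [e] at this
  linarith

lemma eR_conv {z : ℝ → EReal} (hz : IsEnergy z) : ConvexOn ℝ {a | z a ≠ ⊤} (eR z) := by
  refine LinearOrder.convexOn_of_lt (aux_conv hz).1 ?_
  intro x hx y hy hxy a b ha hb hab
  have hx0 := aux_nonneg hz hx
  simp only [smul_eq_mul]
  obtain ⟨m, hm⟩ : ∃ m, m = a * x + b * y := ⟨_, rfl⟩
  rw [← hm]
  have hxm : m - x = b * (y - x) := by rw [hm]; linear_combination x * hab
  have hym : y - m = a * (y - x) := by rw [hm]; linear_combination (-y) * hab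
  have p0 : 0 < y - x := by linarith
  have p1 : 0 < m - x := by rw [hxm]; positivity
  have p2 : 0 < y - m := by rw [hym]; positivity
  have hmD : z m ≠ ⊤ := aux_mem hz hy (by linarith) (by linarith)
  have R := eR_right hz (by linarith : 0 ≤ m) hy (by linarith)
  have L := eR_sub hz hx0 hmD (by linarith)
  obtain ⟨p, hp⟩ : ∃ p, (z y).toReal = (z m).toReal + p * (y - m) :=
    ⟨((z y).toReal - (z m).toReal) / (y - m), by field_simp; ring⟩
  have sub : ∀ s, x ≤ s → s ≤ m → (z m).toReal + p * (s - m) ≤ (z s).toReal := by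
    intro s h0 h1
    have c := aux_chord hz (aux_mem hz hy (by linarith) (by linarith) : z s ≠ ⊤) hy h1 (by linarith)
    rw [hp] at c
    refine le_of_mul_le_mul_left ?_ p2
    linarith
  have I := intervalIntegral.integral_mono_on (by linarith : x ≤ m) 
    (f := fun s => ((z m).toReal + p * (x - m)) + p * (s - x))
    (Continuous.intervalIntegrable (by fun_prop) _ _) (aux_ii hz hmD hx0 (by linarith) le_rfl) (by
      rintro s ⟨h0, h1⟩
      have := sub s h0 h1
      linarith)
  rw [aux_aff] at I
  have X := mul_le_mul_of_nonneg_left (sub x le_rfl (by linarith)) hx0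
  have L' : eR z m - eR z x ≤ (m - x) * (m * p - (z m).toReal) := by nlinarith
  have R' : (y - m) * (m * p - (z m).toReal) ≤ eR z y - eR z m := by
    rw [hp] at R; nlinarith
  rw [hxm] at L'
  rw [hym] at R'
  have R2 := mul_le_mul_of_nonneg_left R' hb.le
  have L2 := mul_le_mul_of_nonneg_left L' ha.le
  have : eR z m = a * eR z m + b * eR z m := by rw [← add_mul, hab, one_mul]
  nlinarith

lemma eR_mono {z : ℝ → EReal} (hz : IsEnergy z) {x y : ℝ} (hx : 0 ≤ x) (hy : z y ≠ ⊤) (h : x ≤ y) :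
    eR z x ≤ eR z y := by
  have h00 : z 0 ≠ ⊤ := by rw [hz.zero]; simp
  have c := aux_chord hz h00 hy hx h
  simp only [hz.zero, EReal.toReal_zero, sub_zero, mul_zero, zero_add] at c
  have := eR_right hz hx hy h
  linarith

lemma eFun_top (z : ℝ → EReal) (a : ℝ) : eFun z a = ⊤ ↔ z a = ⊤ := by
  unfold eFun
  split_ifs with h
  · simp [h]
  · simp only [h, iff_false]; exact EReal.coe_ne_top _

lemma eFun_of (z : ℝ → EReal) {a : ℝ} (h : z a ≠ ⊤) : eFun z a = (eR z a : EReal) := by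
  unfold eFun eR
  rw [if_neg h]

lemma aux_ev {z : ℝ → EReal} (hz : IsEnergy z) (y K : ℝ) (h : (K : EReal) < z y) :
    ∀ᶠ x in 𝓝 y, z x ≠ ⊤ → K < (z x).toReal := by
  filter_upwards [hz.lsc y K h] with x hx hD
  rw [← aux_coe hz hD] at hx
  exact_mod_cast hx

lemma eFun_lsc {z : ℝ → EReal} (hz : IsEnergy z) : LowerSemicontinuous (eFun z) := by
  intro y r hr
  obtain ⟨R, hrR, hR⟩ := EReal.lt_iff_exists_real_btwn.1 hr
  suffices H : ∀ᶠ x in 𝓝 y, z x ≠ ⊤ → R < eR z x by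
    filter_upwards [H] with x hx
    by_cases h : z x = ⊤
    · rw [(eFun_top z x).2 h]; exact hrR.trans (EReal.coe_lt_top _)
    · rw [eFun_of z h]; exact hrR.trans (by exact_mod_cast hx h)
  by_cases hy : z y = ⊤
  · rcases lt_trichotomy y 0 with h | h | h
    · filter_upwards [Iio_mem_nhds h] with x hx hD
      exact absurd (hz.top_of_neg x hx) hD
    · rw [h, hz.zero] at hy; simp at hy
    · have hy2 : y / 2 < y := by linarith
      by_cases hc : z (y / 2) = ⊤
      · filter_upwards [Ioi_mem_nhds hy2] with x hx hD
        exact absurd hc (aux_mem hz hD (by linarith) (le_of_lt hx))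
      · obtain ⟨K, hK⟩ : ∃ K : ℝ, R - eR z (y/2) + (y * |(z (y/2)).toReal|) = (y / 2) * K := 
          ⟨(R - eR z (y/2) + (y * |(z (y/2)).toReal|)) / (y/2), by field_simp⟩
        filter_upwards [Ioi_mem_nhds hy2, aux_ev hz y K (by rw [hy]; exact EReal.coe_lt_top _)]
          with x hx hx2 hD
        have hx : y / 2 < x := hx
        have hxy : x ≤ y := by
          by_contra hh
          exact aux_mem hz hD h.le (by linarith) hy
        have A := eR_right hz (by linarith : 0 ≤ y / 2) hD hx.le
        have B : (y / 2) * K < (y / 2) * (z x).toReal := mul_lt_mul_of_pos_left (hx2 hD) (by linarith)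
        have C : x * (z (y/2)).toReal ≤ y * |(z (y/2)).toReal| := by
          calc x * (z (y/2)).toReal ≤ x * |(z (y/2)).toReal| := by gcongr; linarith; exact le_abs_self _
            _ ≤ _ := by gcongr
        linarith
  · rw [eFun_of z hy] at hR
    have hR : R < eR z y := by exact_mod_cast hR
    have y0 := aux_nonneg hz hy
    obtain ⟨M, hM, hl⟩ := aux_lower hz hy
    obtain ⟨w, hw⟩ : ∃ w, w = (z y).toReal := ⟨_, rfl⟩
    obtain ⟨ε, he, hε⟩ : ∃ ε : ℝ, 0 < ε ∧ y * ε < eR z y - R := by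
      refine ⟨(eR z y - R) / (y + 1), by apply div_pos <;> linarith, ?_⟩
      rw [mul_div_assoc', div_lt_iff₀ (by linarith)]
      nlinarith
    have c1 : ∀ᶠ x in 𝓝 y, R < eR z y + (y * (w - ε) - x * w) := by
      have : ContinuousAt (fun x => eR z y + (y * (w - ε) - x * w)) y := by fun_prop
      exact this.eventually_const_lt (by linarith)
    have c2 : ∀ᶠ x in 𝓝 y, R < eR z y + (x * (w - ε) - y * w - 2 * M * (y - x)) := by
      have : ContinuousAt (fun x => eR z y + (x * (w - ε) - y * w - 2 * M * (y - x))) y := by fun_prop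
      exact this.eventually_const_lt (by linarith)
    filter_upwards [c1, c2, aux_ev hz y (w - ε) (by
      rw [← aux_coe hz hy, ← hw]; exact_mod_cast (by linarith : w - ε < w))] with x h1 h2 h3 hD
    have h3 := h3 hD
    have x0 := aux_nonneg hz hD
    rcases le_total y x with h | h
    · have := eR_right hz y0 hD h
      have B := mul_le_mul_of_nonneg_left h3.le y0
      rw [← hw] at this
      linarith
    · have S := eR_sub hz x0 hy h
      have B := mul_le_mul_of_nonneg_left h3.le x0
      have I := intervalIntegral.integral_mono_on h (f := fun s => -M + 0 * (s - x))
        (Continuous.intervalIntegrable (by fun_prop) _ _) (aux_ii hz hy x0 h le_rfl) (by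
          rintro s ⟨h0, h1⟩
          have := hl s (by linarith) h1
          linarith)
      rw [aux_aff] at I
      rw [← hw] at S
      linarith

/-- `e` is proper, convex, lower semicontinuous; `e(a) = +∞` iff `z(a) = +∞` (in particular
for `a < 0`); `e(0) = 0`; and `e` is nondecreasing where finite. -/
theorem statement4 (z : ℝ → EReal) (hz : IsEnergy z) :
    (∃ a : ℝ, eFun z a ≠ ⊤) ∧ (∀ a : ℝ, eFun z a ≠ ⊥) ∧
    ConvexE (eFun z) ∧ LowerSemicontinuous (eFun z) ∧
    (∀ a : ℝ, eFun z a = ⊤ ↔ z a = ⊤) ∧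
    (∀ a : ℝ, a < 0 → eFun z a = ⊤) ∧
    eFun z 0 = 0 ∧
    (∀ a₀ a₁ : ℝ, a₀ ≤ a₁ → eFun z a₀ ≠ ⊤ → eFun z a₁ ≠ ⊤ → eFun z a₀ ≤ eFun z a₁) := by
  have hb : ∀ a : ℝ, eFun z a ≠ ⊥ := by
    intro a
    by_cases h : z a = ⊤
    · rw [(eFun_top z a).2 h]; simp
    · rw [eFun_of z h]; exact EReal.coe_ne_bot _
  have h00 : z 0 ≠ ⊤ := by rw [hz.zero]; simp
  have he0 : eFun z 0 = 0 := by rw [eFun_of z h00]; simp [eR]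
  refine ⟨⟨0, by rw [he0]; simp⟩, hb, ?_, eFun_lsc hz, eFun_top z,
    fun a ha => (eFun_top z a).2 (hz.top_of_neg a ha), he0, ?_⟩
  · apply aux_conv_ne_bot_le _ hb
    have : {a | eFun z a ≠ ⊤} = {a | z a ≠ ⊤} := by ext a; simp [eFun_top]
    rw [this]
    refine (eR_conv hz).congr ?_
    intro a ha
    simp only [eFun_of z ha, EReal.toReal_coe]
  · intro a b hab ha hb'
    rw [Ne, eFun_top] at ha hb'
    rw [eFun_of z ha, eFun_of z hb']
    exact_mod_cast eR_mono hz (aux_nonneg hz ha) hb' hab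
end
end

section
/- Let z : ℝ → ℝ ∪ {+∞} be an energy satisfying (z1)–(z3) and define e from z as above. Then limsup_{a→0⁺} e(a)/a = 0, and liminf_{b→+∞} e*(b)/b > 0; more precisely, liminf_{b→+∞} e*(b)/b ≥ a₀ for every a₀ > 0 with e(a₀) < +∞. -/
open MeasureTheory Filter Set Topology

noncomputable section

theorem energy_fin (z : ℝ → EReal) (hz : IsEnergy z) : ∃ a : ℝ, 0 < a ∧ z a ≠ ⊤ := by
  obtain ⟨a, ha, L, hL, -⟩ := hz.slope
  refine ⟨a, ha, fun htop => ?_⟩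
  have h : L ∈ subdiff z a := by rw [hL]; rfl
  have h0 := h 0
  rw [htop, hz.zero, EReal.top_add_coe] at h0
  exact absurd h0 (by simp)

theorem energy_tendsto (z : ℝ → EReal) (hz : IsEnergy z) :
    ∀ ε : ℝ, 0 < ε → ∃ δ : ℝ, 0 < δ ∧ ∀ a : ℝ, 0 < a → a < δ →
      z a ≠ ⊤ ∧ |(z a).toReal| ≤ ε := by
  intro ε hε
  obtain ⟨a₁, ha₁, hfin⟩ := energy_fin z hz
  obtain ⟨w, hw⟩ : ∃ w : ℝ, z a₁ = w := ⟨(z a₁).toReal, (EReal.coe_toReal hfin (hz.ne_bot _)).symm⟩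
  have hl := hz.lsc 0 ((-ε : ℝ) : EReal) (by show _ < z 0; rw [hz.zero]; exact_mod_cast (by linarith : -ε < 0))
  obtain ⟨δ₁, hδ₁, hl⟩ := Metric.eventually_nhds_iff.1 hl
  have hW : 0 < |w| + 1 := by positivity
  refine ⟨min δ₁ (min a₁ (a₁ * ε / (|w| + 1))), by positivity, fun a ha hlt => ?_⟩
  rw [lt_min_iff, lt_min_iff] at hlt
  obtain ⟨h1, h2, h3⟩ := hlt
  have hlo : ((-ε : ℝ) : EReal) < z a := @hl a (by rw [Real.dist_eq, sub_zero, abs_of_pos ha]; exact h1)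
  have hup := hz.convex a₁ 0 (a / a₁) (by positivity) ((div_lt_one ha₁).2 h2)
  rw [hw, hz.zero, mul_zero, add_zero, mul_zero, add_zero, div_mul_cancel₀ _ ha₁.ne',
    ← EReal.coe_mul] at hup
  have hne : z a ≠ ⊤ := fun h => by rw [h] at hup; exact absurd (top_le_iff.1 hup) (EReal.coe_ne_top _)
  obtain ⟨v, hv⟩ : ∃ v : ℝ, z a = v := ⟨(z a).toReal, (EReal.coe_toReal hne (hz.ne_bot _)).symm⟩
  refine ⟨hne, ?_⟩
  rw [hv] at hup hlo ⊢
  rw [EReal.toReal_coe]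
  have hup' : v ≤ a / a₁ * w := by exact_mod_cast hup
  have hlo' : -ε < v := by exact_mod_cast hlo
  rw [lt_div_iff₀ hW] at h3
  have : a / a₁ * w ≤ ε := by
    rw [div_mul_eq_mul_div, div_le_iff₀ ha₁]
    nlinarith [le_abs_self w]
  rw [abs_le]
  constructor <;> linarith

theorem eFun_tendsto (z : ℝ → EReal) (hz : IsEnergy z) :
    Tendsto (fun a : ℝ => eFun z a / (a : EReal)) (𝓝[>] (0:ℝ)) (𝓝 0) := by
  have key : Tendsto (fun a : ℝ => (a * (z a).toReal - 2 * ∫ s in (0:ℝ)..a, (z s).toReal) / a)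
      (𝓝[>] (0:ℝ)) (𝓝 0) := by
    rw [Metric.tendsto_nhds]
    intro ε hε
    obtain ⟨δ, hδ, h⟩ := energy_tendsto z hz (ε / 4) (by positivity)
    filter_upwards [Ioo_mem_nhdsGT hδ] with a ha
    have hI : ‖∫ s in (0:ℝ)..a, (z s).toReal‖ ≤ ε / 4 * |a - 0| := by
      apply intervalIntegral.norm_integral_le_of_norm_le_const
      intro x hx
      rw [uIoc_of_le ha.1.le] at hx
      exact (h x hx.1 (hx.2.trans_lt ha.2)).2
    have hza := (h a ha.1 ha.2).2
    have ha0 := ha.1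
    rw [sub_zero, abs_of_pos ha0, Real.norm_eq_abs, abs_le] at hI
    rw [abs_le] at hza
    rw [Real.dist_eq, sub_zero, abs_lt, lt_div_iff₀ ha0, div_lt_iff₀ ha0]
    have : 0 < ε * a := by positivity
    constructor <;> nlinarith
  have key2 : Tendsto (fun a : ℝ =>
      (((a * (z a).toReal - 2 * ∫ s in (0:ℝ)..a, (z s).toReal) / a : ℝ) : EReal))
      (𝓝[>] (0:ℝ)) (𝓝 0) := by
    exact_mod_cast (continuous_coe_real_ereal.tendsto 0).comp key
  refine key2.congr' ?_
  obtain ⟨δ, hδ, h⟩ := energy_tendsto z hz 1 one_pos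
  filter_upwards [Ioo_mem_nhdsGT hδ] with a ha
  rw [eFun, if_neg (h a ha.1 ha.2).1, EReal.coe_div]

theorem conj_bound (z : ℝ → EReal) (a₀ : ℝ) (h : eFun z a₀ ≠ ⊤) :
    (a₀ : EReal) ≤ Filter.liminf (fun b : ℝ => conj (eFun z) b / (b : EReal)) Filter.atTop := by
  obtain ⟨c, hc⟩ : ∃ c : ℝ, eFun z a₀ = c := by
    unfold eFun at h ⊢
    split_ifs at h ⊢ with h'
    · exact absurd rfl h
    · exact ⟨_, rfl⟩
  have h1 : Tendsto (fun b : ℝ => a₀ - c / b) atTop (𝓝 a₀) := by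
    simpa using (tendsto_const_nhds (x := a₀)).sub (tendsto_id.const_div_atTop c)
  have h2 : Tendsto (fun b : ℝ => ((a₀ - c / b : ℝ) : EReal)) atTop (𝓝 (a₀ : EReal)) :=
    (continuous_coe_real_ereal.tendsto a₀).comp h1
  rw [← h2.liminf_eq]
  refine Filter.liminf_le_liminf ?_
  filter_upwards [eventually_gt_atTop (0:ℝ)] with b hb
  have h3 : ((a₀ * b - c : ℝ) : EReal) ≤ conj (eFun z) b := by
    have := le_iSup (fun a : ℝ => ((a * b : ℝ) : EReal) - eFun z a) a₀
    simp only [hc, ← EReal.coe_sub] at this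
    exact this
  have h4 : a₀ - c / b = (a₀ * b - c) / b := by field_simp
  rw [h4, EReal.coe_div]
  exact EReal.div_le_div_right_of_nonneg (by exact_mod_cast hb.le) h3

/-- `limsup_{a→0⁺} e(a)/a = 0` and `liminf_{b→∞} e*(b)/b > 0`; more precisely the latter
liminf is at least `a₀` for every `a₀ > 0` with `e(a₀) < ∞`. -/
theorem statement5 (z : ℝ → EReal) (hz : IsEnergy z) :
    Filter.limsup (fun a : ℝ => eFun z a / (a : EReal)) (𝓝[>] (0:ℝ)) = 0 ∧
    0 < Filter.liminf (fun b : ℝ => conj (eFun z) b / (b : EReal)) Filter.atTop ∧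
    (∀ a₀ : ℝ, 0 < a₀ → eFun z a₀ ≠ ⊤ →
      (a₀ : EReal) ≤ Filter.liminf (fun b : ℝ => conj (eFun z) b / (b : EReal)) Filter.atTop) := by
  refine ⟨(eFun_tendsto z hz).limsup_eq, ?_, fun a₀ _ h => conj_bound z a₀ h⟩
  obtain ⟨a, ha, hfin⟩ := energy_fin z hz
  refine lt_of_lt_of_le ?_ (conj_bound z a ?_)
  · exact_mod_cast ha
  · rw [eFun, if_neg hfin]
    exact EReal.coe_ne_top _
end
end

section
/- Let z : ℝ → ℝ ∪ {+∞} be an energy satisfying (z1)–(z3), define e from z as above, and let a > 0. Then ∂e(a) = {a·b − z(a) : b ∈ ∂z(a)} = {z*(b) : b ∈ ∂z(a)} (all three sets being empty when z(a) = +∞). Consequently, ∂e(a) is a singleton if and only if ∂z(a) is a singleton. -/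
open MeasureTheory Filter Set Topology

noncomputable section

lemma aff_int (p q r x y : ℝ) :
    ∫ s in x..y, (p + q * (s - r)) = p * (y - x) + q * ((y - r)^2 - (x - r)^2) / 2 := by
  have h : ∀ s ∈ Set.uIcc x y, HasDerivAt (fun s : ℝ => p * s + q * (s - r)^2 / 2)
      (p + q * (s - r)) s := by
    intro s _
    have h1 := (hasDerivAt_id s).const_mul p
    have h2 := ((((hasDerivAt_id s).sub_const r).pow 2).const_mul q).div_const 2
    have h3 := h1.add h2
    have e : p * 1 + q * ((2:ℕ) * (id s - r) ^ (2 - 1) * 1) / 2 = p + q * (s - r) := by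
      simp only [id]; norm_num; ring
    rw [e] at h3
    exact h3
  rw [intervalIntegral.integral_eq_sub_of_hasDerivAt h
    (Continuous.intervalIntegrable (by fun_prop) _ _)]
  ring

lemma chord_le {D : Set ℝ} {f : ℝ → ℝ} (hf : ConvexOn ℝ D f) {x y s : ℝ} (hx : x ∈ D) (hy : y ∈ D)
    (h1 : x ≤ s) (h2 : s ≤ y) : (y - x) * f s ≤ (y - s) * f x + (s - x) * f y := by
  rcases eq_or_lt_of_le (h1.trans h2) with h | h
  · subst h
    have : s = x := le_antisymm h2 h1
    subst this; simp
  · have hd : 0 < y - x := by linarith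
    have p1 : 0 ≤ (y - s) / (y - x) := div_nonneg (by linarith) hd.le
    have p2 : 0 ≤ (s - x) / (y - x) := div_nonneg (by linarith) hd.le
    have p3 : (y - s) / (y - x) + (s - x) / (y - x) = 1 := by field_simp; ring
    have := hf.2 hx hy p1 p2 p3
    have e : ((y - s) / (y - x)) • x + ((s - x) / (y - x)) • y = s := by
      simp only [smul_eq_mul]; field_simp; ring
    rw [e] at this
    simp only [smul_eq_mul] at this
    have h3 := mul_le_mul_of_nonneg_left this hd.le
    have e2 : (y - x) * ((y - s) / (y - x) * f x + (s - x) / (y - x) * f y)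
      = (y - s) * f x + (s - x) * f y := by field_simp
    linarith

lemma mem_conv {D : Set ℝ} {f : ℝ → ℝ} (hf : ConvexOn ℝ D f) {x y s : ℝ} (hx : x ∈ D) (hy : y ∈ D)
    (h1 : x ≤ s) (h2 : s ≤ y) : s ∈ D := hf.1.ordConnected.out hx hy ⟨h1, h2⟩

lemma trap {D : Set ℝ} {f : ℝ → ℝ} (hf : ConvexOn ℝ D f) {x y : ℝ} (hx : x ∈ D) (hy : y ∈ D)
    (hxy : x < y) (hi : IntervalIntegrable f volume x y) :
    2 * ∫ s in x..y, f s ≤ (y - x) * (f x + f y) := by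
  have hd : 0 < y - x := by linarith
  have h : ∫ s in x..y, f s ≤ ∫ s in x..y, (f x + (f y - f x) / (y - x) * (s - x)) := by
    apply intervalIntegral.integral_mono_on hxy.le hi
      (Continuous.intervalIntegrable (by fun_prop) _ _)
    intro s hs
    have := chord_le hf hx hy hs.1 hs.2
    rw [← sub_nonneg]
    have e : f x + (f y - f x) / (y - x) * (s - x) - f s
      = ((y - s) * f x + (s - x) * f y - (y - x) * f s) / (y - x) := by field_simp; ring
    rw [e]
    exact div_nonneg (by linarith) hd.le
  rw [aff_int] at h
  have e : f x * (y - x) + (f y - f x) / (y - x) * ((y - x)^2 - (x - x)^2) / 2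
    = (y - x) * (f x + f y) / 2 := by field_simp; ring
  rw [e] at h
  linarith

lemma core {D : Set ℝ} {f : ℝ → ℝ} (hf : ConvexOn ℝ D f) (h0 : (0:ℝ) ∈ D) (f0 : f 0 = 0)
    (hD : ∀ x ∈ D, 0 ≤ x) (hi : ∀ x ∈ D, IntervalIntegrable f volume 0 x)
    {a : ℝ} (ha : 0 < a) (haD : a ∈ D) (b : ℝ) :
    (∀ x ∈ D, (a * f a - 2 * ∫ s in (0:ℝ)..a, f s) + (a * b - f a) * (x - a)
        ≤ x * f x - 2 * ∫ s in (0:ℝ)..x, f s) ↔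
    (∀ x ∈ D, f a + b * (x - a) ≤ f x) := by
  have hii : ∀ x ∈ D, ∀ y ∈ D, IntervalIntegrable f volume x y :=
    fun x hx y hy => (hi x hx).symm.trans (hi y hy)
  have hI : ∀ x ∈ D, ∀ y ∈ D, (∫ s in (0:ℝ)..y, f s) - ∫ s in (0:ℝ)..x, f s = ∫ s in x..y, f s :=
    fun x hx y hy => intervalIntegral.integral_interval_sub_left (hi y hy) (hi x hx)
  constructor
  · intro H x hx
    rcases lt_trichotomy x a with hxa | rfl | hxa
    · have h1 := H x hx
      have h2 := trap hf hx haD hxa (hii x hx a haD)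
      rw [← hI x hx a haD] at h2
      have : a * (f a + b * (x - a)) ≤ a * f x := by nlinarith
      exact le_of_mul_le_mul_left this ha
    · simp
    · by_contra hcon
      push Not at hcon
      have hd : 0 < x - a := by linarith
      set s0 := (f x - f a) / (x - a) with hs0
      have hs0b : s0 < b := by
        rw [hs0, div_lt_iff₀ hd]; linarith
      have hs0e : s0 * (x - a) = f x - f a := by rw [hs0]; field_simp
      have key : ∀ y ∈ Set.Ioc a x, a * b ≤ y * s0 - f a / a * (y - a) := by
        intro y hy
        have hyD : y ∈ D := mem_conv hf haD hx hy.1.le hy.2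
        have hya : 0 < y - a := by linarith [hy.1]
        have hlow : ∫ s in a..y, (f a + f a / a * (s - a)) ≤ ∫ s in a..y, f s := by
          apply intervalIntegral.integral_mono_on hy.1.le
            (Continuous.intervalIntegrable (by fun_prop) _ _) (hii a haD y hyD)
          intro s hs
          have hsD : s ∈ D := mem_conv hf haD hyD hs.1 hs.2
          have := chord_le hf h0 hsD ha.le hs.1
          rw [f0] at this
          have e : f a + f a / a * (s - a) = s * f a / a := by field_simp; ring
          rw [e, div_le_iff₀ ha]
          linarith
        rw [aff_int, ← hI a haD y hyD] at hlow
        have hup : f y ≤ f a + s0 * (y - a) := by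
          have := chord_le hf haD hx hy.1.le hy.2
          have : (x - a) * f y ≤ (x - a) * (f a + s0 * (y - a)) := by
            have e : (x - a) * (f a + s0 * (y - a)) = (x - a) * f a + (s0 * (x - a)) * (y - a) := by ring
            rw [e, hs0e]; linarith
          exact le_of_mul_le_mul_left this hd
        have h1 := H y hyD
        have h3 : y * f y ≤ y * (f a + s0 * (y - a)) :=
          mul_le_mul_of_nonneg_left hup (hD y hyD)
        have : (y - a) * (a * b) ≤ (y - a) * (y * s0 - f a / a * (y - a)) := by
          nlinarith
        exact le_of_mul_le_mul_left this hya
      have hlim : Tendsto (fun y : ℝ => y * s0 - f a / a * (y - a)) (𝓝[>] a)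
          (𝓝 (a * s0 - f a / a * (a - a))) :=
        (Continuous.tendsto (by fun_prop) a).mono_left nhdsWithin_le_nhds
      have := ge_of_tendsto hlim (b := a * b) (by
        filter_upwards [Ioc_mem_nhdsGT hxa] with y hy using key y hy)
      nlinarith
  · intro H x hx
    rcases lt_trichotomy x a with hxa | rfl | hxa
    · have hd : 0 < a - x := by linarith
      have hlow : ∫ s in x..a, (f a + b * (s - a)) ≤ ∫ s in x..a, f s := by
        apply intervalIntegral.integral_mono_on hxa.le
          (Continuous.intervalIntegrable (by fun_prop) _ _) (hii x hx a haD)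
        intro s hs
        exact H s (mem_conv hf hx haD hs.1 hs.2)
      rw [aff_int, ← hI x hx a haD] at hlow
      have := mul_le_mul_of_nonneg_left (H x hx) (hD x hx)
      nlinarith
    · simp
    · have h2 := trap hf haD hx hxa (hii a haD x hx)
      rw [← hI a haD x hx] at h2
      have := mul_le_mul_of_nonneg_left (H x hx) ha.le
      nlinarith

lemma mem_subdiff_iff {F : ℝ → EReal} (D : Set ℝ) (g : ℝ → ℝ) (h1 : ∀ x ∈ D, F x = (g x : EReal))
    (h2 : ∀ x ∉ D, F x = ⊤) {a : ℝ} (ha : a ∈ D) (b : ℝ) :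
    b ∈ subdiff F a ↔ ∀ x ∈ D, g a + b * (x - a) ≤ g x := by
  unfold subdiff
  simp only [Set.mem_ofPred_eq]
  constructor
  · intro H x hx
    have := H x
    rw [h1 a ha, h1 x hx] at this
    exact_mod_cast this
  · intro H x
    by_cases hx : x ∈ D
    · rw [h1 a ha, h1 x hx]
      exact_mod_cast H x hx
    · rw [h2 x hx]; exact le_top

lemma subdiff_empty {F : ℝ → EReal} (h0 : F 0 = 0) {a : ℝ} (ha : F a = ⊤) : subdiff F a = ∅ := by
  ext b
  simp only [subdiff, Set.mem_ofPred_eq, Set.mem_empty_iff_false, iff_false]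
  intro H
  have := H 0
  rw [ha, h0, EReal.top_add_coe] at this
  simp at this

lemma energy_conv {z : ℝ → EReal} (hz : IsEnergy z) :
    ConvexOn ℝ {x | z x ≠ ⊤} (fun x => (z x).toReal) := by
  have key : ∀ x y, z x ≠ ⊤ → z y ≠ ⊤ → ∀ t : ℝ, 0 < t → t < 1 →
      z (t * x + (1 - t) * y) ≤ ((t * (z x).toReal + (1 - t) * (z y).toReal : ℝ) : EReal) := by
    intro x y hx hy t h0 h1
    have := hz.convex x y t h0 h1
    rw [← EReal.coe_toReal hx (hz.ne_bot x), ← EReal.coe_toReal hy (hz.ne_bot y)] at this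
    exact_mod_cast this
  rw [convexOn_iff_forall_pos]
  refine ⟨?_, ?_⟩
  · rw [convex_iff_forall_pos]
    intro x hx y hy s t hs ht hst
    have := key x y hx hy s hs (by linarith)
    obtain rfl : t = 1 - s := by linarith
    exact ne_top_of_le_ne_top (EReal.coe_ne_top _) this
  · intro x hx y hy s t hs ht hst
    have := key x y hx hy s hs (by linarith)
    obtain rfl : t = 1 - s := by linarith
    have := EReal.toReal_le_toReal this (hz.ne_bot _) (EReal.coe_ne_top _)
    rwa [EReal.toReal_coe] at this

lemma energy_int {z : ℝ → EReal} (hz : IsEnergy z) {x : ℝ} (hx : z x ≠ ⊤) :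
    IntervalIntegrable (fun s => (z s).toReal) volume 0 x := by
  have hx0 : 0 ≤ x := by
    by_contra h
    exact hx (hz.top_of_neg x (by linarith))
  have hc := energy_conv hz
  have h0 : (0:ℝ) ∈ {x | z x ≠ ⊤} := by simp [hz.zero]
  have hmeas : Measurable (fun s => (z s).toReal) := hz.lsc.measurable.ereal_toReal
  obtain ⟨m, hm, hmin⟩ := LowerSemicontinuousOn.exists_isMinOn (s := Set.Icc 0 x) ⟨0, by simp [hx0]⟩
    isCompact_Icc (hz.lsc.lowerSemicontinuousOn _)
  rw [intervalIntegrable_iff_integrableOn_Icc_of_le hx0]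
  apply Measure.integrableOn_of_bounded (M := |(z m).toReal| + |(z x).toReal|) (by simp)
    hmeas.aestronglyMeasurable
  rw [ae_restrict_iff' measurableSet_Icc]
  refine Eventually.of_forall fun s hs => ?_
  have hsD : z s ≠ ⊤ := mem_conv hc h0 hx hs.1 hs.2
  have hl : (z m).toReal ≤ (z s).toReal :=
    EReal.toReal_le_toReal (hmin hs) (hz.ne_bot _) hsD
  have hu : (z s).toReal ≤ |(z x).toReal| := by
    have hch := chord_le hc h0 hx hs.1 hs.2
    simp only [hz.zero, EReal.toReal_zero] at hch
    rcases eq_or_lt_of_le hx0 with h | h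
    · have : s = x := by linarith [hs.1, hs.2]
      rw [this]; exact le_abs_self _
    · have h3 := mul_le_mul_of_nonneg_left (le_abs_self (z x).toReal) hs.1
      have h4 := mul_le_mul_of_nonneg_right hs.2 (abs_nonneg (z x).toReal)
      have : x * (z s).toReal ≤ x * |(z x).toReal| := by linarith
      exact le_of_mul_le_mul_left this h
  rw [Real.norm_eq_abs, abs_le]
  constructor
  · linarith [neg_abs_le (z m).toReal, abs_nonneg (z x).toReal]
  · linarith [abs_nonneg (z m).toReal]

lemma conj_eq {z : ℝ → EReal} (hz : IsEnergy z) {a b : ℝ} (ha : z a ≠ ⊤) (hb : b ∈ subdiff z a) :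
    conj z b = ((a * b : ℝ) : EReal) - z a := by
  apply le_antisymm
  · apply iSup_le
    intro x
    by_cases hx : z x = ⊤
    · rw [hx, EReal.sub_top]; exact bot_le
    · have := hb x
      rw [← EReal.coe_toReal hx (hz.ne_bot x), ← EReal.coe_toReal ha (hz.ne_bot a)] at this ⊢
      norm_cast at this ⊢
      nlinarith
  · exact le_iSup (fun x : ℝ => ((x * b : ℝ) : EReal) - z x) a

theorem statement6 (z : ℝ → EReal) (hz : IsEnergy z) (a : ℝ) (ha : 0 < a) :
    subdiff (eFun z) a
      = {c : ℝ | ∃ b ∈ subdiff z a, (c : EReal) = ((a * b : ℝ) : EReal) - z a} ∧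
    subdiff (eFun z) a
      = {c : ℝ | ∃ b ∈ subdiff z a, (c : EReal) = conj z b} ∧
    ((∃ c : ℝ, subdiff (eFun z) a = {c}) ↔ (∃ b : ℝ, subdiff z a = {b})) := by
  have e0 : eFun z 0 = 0 := by simp [eFun, hz.zero]
  by_cases hza : z a = ⊤
  · have h1 := subdiff_empty hz.zero hza
    have h2 := subdiff_empty e0 (a := a) (by simp [eFun, hza])
    rw [h1, h2]
    simp
  have hD : ∀ x ∈ {x | z x ≠ ⊤}, 0 ≤ x := by
    intro x hx
    by_contra h
    exact hx (hz.top_of_neg x (by linarith))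
  have hcore := core (energy_conv hz) (by simp [hz.zero]) (by simp [hz.zero]) hD
    (fun x hx => energy_int hz hx) ha hza
  have hsz := mem_subdiff_iff (F := z) {x | z x ≠ ⊤} (fun x => (z x).toReal)
    (fun x hx => (EReal.coe_toReal hx (hz.ne_bot x)).symm) (fun x hx => by simpa using hx) hza
  have hse := mem_subdiff_iff (F := eFun z) {x | z x ≠ ⊤}
    (fun x => x * (z x).toReal - 2 * ∫ s in (0:ℝ)..x, (z s).toReal)
    (fun x hx => if_neg hx)
    (fun x hx => if_pos (by simpa using hx)) hza
  have hiff : ∀ b, a * b - (z a).toReal ∈ subdiff (eFun z) a ↔ b ∈ subdiff z a := by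
    intro b
    rw [hsz, hse]
    exact hcore b
  have hcoe : ∀ b c : ℝ, (c : EReal) = ((a * b : ℝ) : EReal) - z a ↔ c = a * b - (z a).toReal := by
    intro b c
    conv_lhs => rw [← EReal.coe_toReal hza (hz.ne_bot a)]
    norm_cast
  have hinv : ∀ c : ℝ, a * ((c + (z a).toReal) / a) - (z a).toReal = c := by
    intro c; field_simp; ring
  have h1 : subdiff (eFun z) a
      = {c : ℝ | ∃ b ∈ subdiff z a, (c : EReal) = ((a * b : ℝ) : EReal) - z a} := by
    ext c
    simp only [Set.mem_ofPred_eq, hcoe]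
    constructor
    · intro hc
      refine ⟨(c + (z a).toReal) / a, ?_, (hinv c).symm⟩
      rw [← hiff, hinv]; exact hc
    · rintro ⟨b, hb, rfl⟩
      exact (hiff b).2 hb
  refine ⟨h1, ?_, ?_⟩
  · rw [h1]
    ext c
    simp only [Set.mem_ofPred_eq]
    constructor
    · rintro ⟨b, hb, h⟩
      exact ⟨b, hb, by rw [conj_eq hz hza hb]; exact h⟩
    · rintro ⟨b, hb, h⟩
      exact ⟨b, hb, by rw [← conj_eq hz hza hb]; exact h⟩
  · constructor
    · rintro ⟨c, hc⟩
      refine ⟨(c + (z a).toReal) / a, ?_⟩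
      ext b
      rw [← hiff, hc, Set.mem_singleton_iff, Set.mem_singleton_iff, eq_div_iff ha.ne']
      constructor <;> intro h <;> linarith
    · rintro ⟨b, hb⟩
      refine ⟨a * b - (z a).toReal, ?_⟩
      ext c
      rw [← hinv c, hiff, hb, Set.mem_singleton_iff, Set.mem_singleton_iff, hinv c,
        div_eq_iff ha.ne']
      constructor <;> intro h <;> linarith
end
end

section
/- Let f, f_k : ℝ → ℝ ∪ {+∞} be proper, lower semicontinuous, convex functions with the effective domain f^{-1}(ℝ) of f not a singleton, and suppose f_k(a) → f(a) for every a ∈ ℝ (convergence in ℝ ∪ {+∞}). If f is differentiable at a point a ∈ ℝ (with finite derivative f′(a)), then for every ε > 0 there exists N such that for all k ≥ N the subdifferential ∂f_k(a) is nonempty and contained in [f′(a) − ε, f′(a) + ε]; equivalently, sup ∂f_k(a) → f′(a) and inf ∂f_k(a) → f′(a) as k → ∞. -/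
open MeasureTheory Filter Set Topology

noncomputable section

/-- A proper, lower semicontinuous, convex function `ℝ → ℝ ∪ {+∞}`. -/
structure ProperConvex (f : ℝ → EReal) : Prop where
  proper : ∃ a : ℝ, f a ≠ ⊤
  ne_bot : ∀ a : ℝ, f a ≠ ⊥
  lsc : LowerSemicontinuous f
  convex : ConvexE f

lemma real_convex_aux {f : ℝ → EReal} (hf : ProperConvex f) {x a y : ℝ} (hx : x < a) (hy : a < y)
    (fx : f x ≠ ⊤) (fa : f a ≠ ⊤) (fy : f y ≠ ⊤) :
    ((f a).toReal - (f x).toReal) / (a - x) ≤ ((f y).toReal - (f a).toReal) / (y - a) := by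
  have hyx : 0 < y - x := by linarith
  have h := hf.convex x y ((y - a) / (y - x)) (div_pos (by linarith) hyx)
    ((div_lt_one hyx).2 (by linarith))
  have e : (y - a) / (y - x) * x + (1 - (y - a) / (y - x)) * y = a := by
    field_simp
    ring
  rw [e] at h
  rw [← EReal.coe_toReal fx (hf.ne_bot x), ← EReal.coe_toReal fa (hf.ne_bot a),
    ← EReal.coe_toReal fy (hf.ne_bot y)] at h
  have h' : (f a).toReal ≤ (y - a) / (y - x) * (f x).toReal
      + (1 - (y - a) / (y - x)) * (f y).toReal := by exact_mod_cast h
  have h2 : (f a).toReal * (y - x) ≤ (y - a) * (f x).toReal + (a - x) * (f y).toReal := by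
    have := mul_le_mul_of_nonneg_right h' hyx.le
    have e2 : ((y - a) / (y - x) * (f x).toReal
      + (1 - (y - a) / (y - x)) * (f y).toReal) * (y - x)
      = (y - a) * (f x).toReal + (a - x) * (f y).toReal := by
      field_simp
      ring
    linarith
  rw [div_le_div_iff₀ (by linarith) (by linarith)]
  linarith

lemma subdiff_nonempty_aux {f : ℝ → EReal} (hf : ProperConvex f) {a p q : ℝ} (hp : p < a)
    (hq : a < q) (fp : f p ≠ ⊤) (fa : f a ≠ ⊤) (fq : f q ≠ ⊤) : (subdiff f a).Nonempty := by
  obtain ⟨b, hb1, hb2⟩ := exists_between_of_forall_le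
    (s := {s : ℝ | ∃ x, x < a ∧ f x ≠ ⊤ ∧ s = ((f a).toReal - (f x).toReal) / (a - x)})
    (t := {s : ℝ | ∃ y, a < y ∧ f y ≠ ⊤ ∧ s = ((f y).toReal - (f a).toReal) / (y - a)})
    ⟨_, p, hp, fp, rfl⟩ ⟨_, q, hq, fq, rfl⟩ (by
      rintro _ ⟨x, hx, fx, rfl⟩ _ ⟨y, hy, fy, rfl⟩
      exact real_convex_aux hf hx hy fx fa fy)
  refine ⟨b, fun x => ?_⟩
  by_cases fx : f x = ⊤
  · rw [fx]; exact le_top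
  rw [← EReal.coe_toReal fx (hf.ne_bot x), ← EReal.coe_toReal fa (hf.ne_bot a)]
  norm_cast
  rcases lt_trichotomy x a with h | h | h
  · have := hb1 ⟨x, h, fx, rfl⟩
    rw [div_le_iff₀ (by linarith)] at this
    linarith
  · subst h; simp
  · have := hb2 ⟨x, h, fx, rfl⟩
    rw [le_div_iff₀ (by linarith)] at this
    linarith

/-- If proper lsc convex `f_k → f` pointwise, the effective domain of `f` is not a singleton,
and `f` is differentiable at `a` with finite derivative `L`, then for every `ε > 0` and all
large `k` the subdifferential `∂f_k(a)` is nonempty and contained in `[L - ε, L + ε]`. -/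
theorem statement14 (f : ℝ → EReal) (fk : ℕ → ℝ → EReal)
    (hf : ProperConvex f) (hfk : ∀ k, ProperConvex (fk k))
    (hdom : ∃ a b : ℝ, a ≠ b ∧ f a ≠ ⊤ ∧ f b ≠ ⊤)
    (hconv : ∀ a : ℝ, Tendsto (fun k => fk k a) atTop (𝓝 (f a)))
    (a L : ℝ) (hfin : ∀ᶠ x in 𝓝 a, f x ≠ ⊤)
    (hderiv : HasDerivAt (fun x => (f x).toReal) L a) :
    ∀ ε : ℝ, 0 < ε → ∃ N : ℕ, ∀ k ≥ N,
      (subdiff (fk k) a).Nonempty ∧ subdiff (fk k) a ⊆ Set.Icc (L - ε) (L + ε) := by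
  intro ε hε
  have hlo := (hasDerivAt_iff_isLittleO.1 hderiv).def (half_pos hε)
  obtain ⟨δ, hδ, H⟩ := Metric.eventually_nhds_iff.1 (hfin.and hlo)
  have hh : 0 < δ / 2 := half_pos hδ
  obtain ⟨fp, hp⟩ := @H (a - δ / 2) (by rw [Real.dist_eq]; rw [abs_lt]; constructor <;> linarith)
  obtain ⟨fq, hq⟩ := @H (a + δ / 2) (by rw [Real.dist_eq]; rw [abs_lt]; constructor <;> linarith)
  have fa : f a ≠ ⊤ := (@H a (by simpa using hδ)).1
  generalize δ / 2 = h at *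
  have e1 : a - h - a = -h := by ring
  have e2 : a + h - a = h := by ring
  simp only [e1, e2, Real.norm_eq_abs, abs_neg, abs_of_pos hh, smul_eq_mul] at hp hq
  have hp' := (abs_le.1 hp).2
  have hq' := (abs_le.1 hq).2
  have hεh : 0 < ε * h := mul_pos hε hh
  have T : ∀ x, f x ≠ ⊤ → Tendsto (fun k => (fk k x).toReal) atTop (𝓝 (f x).toReal) := fun x hx =>
    (EReal.tendsto_toReal hx (hf.ne_bot x)).comp (hconv x)
  have F : ∀ x, f x ≠ ⊤ → ∀ᶠ k in atTop, fk k x ≠ ⊤ := fun x hx =>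
    (hconv x).eventually (isOpen_ne.mem_nhds hx)
  have E1 : ∀ᶠ k in atTop, (fk k (a + h)).toReal - (fk k a).toReal < (L + ε) * h :=
    ((T _ fq).sub (T _ fa)).eventually_lt_const (by linarith)
  have E2 : ∀ᶠ k in atTop, (fk k (a - h)).toReal - (fk k a).toReal < - (L - ε) * h :=
    ((T _ fp).sub (T _ fa)).eventually_lt_const (by linarith)
  refine eventually_atTop.1 ?_
  filter_upwards [E1, E2, F _ fp, F _ fa, F _ fq] with k k1 k2 kp ka kq
  refine ⟨subdiff_nonempty_aux (hfk k) (by linarith) (by linarith) kp ka kq, fun b hb => ?_⟩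
  have b1 := hb (a - h)
  have b2 := hb (a + h)
  rw [e1, ← EReal.coe_toReal kp ((hfk k).ne_bot _), ← EReal.coe_toReal ka ((hfk k).ne_bot _)] at b1
  rw [e2, ← EReal.coe_toReal kq ((hfk k).ne_bot _), ← EReal.coe_toReal ka ((hfk k).ne_bot _)] at b2
  norm_cast at b1 b2
  constructor
  · refine le_of_mul_le_mul_right ?_ hh
    linarith
  · refine le_of_mul_le_mul_right ?_ hh
    linarith
end
end

section
/- Let f, f_k : ℝ → ℝ ∪ {+∞} be proper, lower semicontinuous, convex functions with the effective domain f^{-1}(ℝ) of f not a singleton, and suppose f_k(a) → f(a) for every a ∈ ℝ (convergence in ℝ ∪ {+∞}). Then f_k converges to f uniformly on every compact subset of the interior of f^{-1}(ℝ): for every compact K contained in the interior of {a : f(a) < +∞}, sup_{a ∈ K} |f_k(a) − f(a)| → 0 as k → ∞ (in particular f_k is finite on K for all large k). -/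
open MeasureTheory Filter Set Topology

noncomputable section

lemma conv_real {h : ℝ → EReal} (hh : ProperConvex h) {x y t : ℝ} (t0 : 0 < t) (t1 : t < 1)
    (hx : h x ≠ ⊤) (hy : h y ≠ ⊤) :
    h (t * x + (1 - t) * y) ≠ ⊤ ∧
      (h (t * x + (1 - t) * y)).toReal ≤ t * (h x).toReal + (1 - t) * (h y).toReal := by
  have hc := hh.convex x y t t0 t1
  have hb := hh.ne_bot (t * x + (1 - t) * y)
  rw [← EReal.coe_toReal hx (hh.ne_bot x), ← EReal.coe_toReal hy (hh.ne_bot y)] at hc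
  have hc2 : h (t * x + (1 - t) * y) ≤
      ((t * (h x).toReal + (1 - t) * (h y).toReal : ℝ) : EReal) := by
    simpa using hc
  have ht : h (t * x + (1 - t) * y) ≠ ⊤ := ne_top_of_le_ne_top (EReal.coe_ne_top _) hc2
  refine ⟨ht, ?_⟩
  rw [← EReal.coe_toReal ht hb] at hc2
  exact_mod_cast hc2

lemma local_bd {h : ℝ → EReal} (hh : ProperConvex h) {x p s M : ℝ} (s0 : 0 < s) (s1 : s < 1)
    (hx : h x ≠ ⊤) (hp : h (x + p) ≠ ⊤) (hm : h (x - p) ≠ ⊤)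
    (bx : |(h x).toReal| ≤ M) (bp : |(h (x + p)).toReal| ≤ M) (bm : |(h (x - p)).toReal| ≤ M) :
    h (x + s * p) ≠ ⊤ ∧ |(h (x + s * p)).toReal - (h x).toReal| ≤ 2 * M * s := by
  obtain ⟨ht, h1⟩ := conv_real hh s0 s1 hp hx
  have e1 : s * (x + p) + (1 - s) * x = x + s * p := by ring
  rw [e1] at ht h1
  have hs : 0 < 1 + s := by linarith
  obtain ⟨-, h2⟩ := conv_real hh (t := 1 / (1 + s)) (by positivity)
    (by rw [div_lt_one hs]; linarith) ht hm
  have e2 : 1 / (1 + s) * (x + s * p) + (1 - 1 / (1 + s)) * (x - p) = x := by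
    field_simp; ring
  rw [e2] at h2
  have h3 : (1 + s) * (h x).toReal ≤ (h (x + s * p)).toReal + s * (h (x - p)).toReal := by
    have := mul_le_mul_of_nonneg_left h2 hs.le
    refine this.trans (le_of_eq ?_)
    field_simp; ring
  rw [abs_le] at bx bp bm
  refine ⟨ht, abs_le.2 ⟨?_, ?_⟩⟩ <;> nlinarith

lemma local_bd' {h : ℝ → EReal} (hh : ProperConvex h) {x r s M y : ℝ} (r0 : 0 < r) (s1 : s < 1)
    (hx : h x ≠ ⊤) (hp : h (x + r) ≠ ⊤) (hm : h (x - r) ≠ ⊤)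
    (bx : |(h x).toReal| ≤ M) (bp : |(h (x + r)).toReal| ≤ M) (bm : |(h (x - r)).toReal| ≤ M)
    (hy : |y - x| ≤ s * r) :
    h y ≠ ⊤ ∧ |(h y).toReal - (h x).toReal| ≤ 2 * M * s := by
  have hM : 0 ≤ M := (abs_nonneg _).trans bx
  have hs : 0 ≤ s := by
    by_contra hc
    have := abs_nonneg (y - x)
    nlinarith
  rcases lt_trichotomy y x with hlt | rfl | hlt
  · rw [abs_of_neg (by linarith)] at hy
    have hle : (x - y) / r ≤ s := by rw [div_le_iff₀ r0]; linarith
    have := local_bd hh (x := x) (p := -r) (s := (x - y) / r) (M := M)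
      (div_pos (by linarith) r0) (hle.trans_lt s1) hx
      (by simpa [sub_eq_add_neg] using hm) (by simpa using hp) bx
      (by simpa [sub_eq_add_neg] using bm) (by simpa using bp)
    have e : x + (x - y) / r * -r = y := by field_simp; ring
    rw [e] at this
    exact ⟨this.1, this.2.trans (by gcongr)⟩
  · refine ⟨hx, ?_⟩
    simp only [sub_self, abs_zero]; positivity
  · rw [abs_of_pos (by linarith)] at hy
    have hle : (y - x) / r ≤ s := by rw [div_le_iff₀ r0]; linarith
    have := local_bd hh (x := x) (p := r) (s := (y - x) / r) (M := M)
      (div_pos (by linarith) r0) (hle.trans_lt s1) hx hp hm bx bp bm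
    have e : x + (y - x) / r * r = y := by field_simp; ring
    rw [e] at this
    exact ⟨this.1, this.2.trans (by gcongr)⟩

/-- If proper lsc convex `f_k → f` pointwise and the effective domain of `f` is not a
singleton, then `f_k → f` uniformly on compact subsets of the interior of the domain of `f`
(in particular `f_k` is finite there for all large `k`). -/
theorem statement15 (f : ℝ → EReal) (fk : ℕ → ℝ → EReal)
    (hf : ProperConvex f) (hfk : ∀ k, ProperConvex (fk k))
    (hdom : ∃ a b : ℝ, a ≠ b ∧ f a ≠ ⊤ ∧ f b ≠ ⊤)
    (hconv : ∀ a : ℝ, Tendsto (fun k => fk k a) atTop (𝓝 (f a))) :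
    ∀ K : Set ℝ, IsCompact K → K ⊆ interior {a : ℝ | f a ≠ ⊤} →
      ∀ ε : ℝ, 0 < ε → ∃ N : ℕ, ∀ k ≥ N, ∀ a ∈ K,
        fk k a ≠ ⊤ ∧ |(fk k a).toReal - (f a).toReal| ≤ ε := by
  intro K hK hKi ε hε
  have ev : ∀ a, f a ≠ ⊤ → ∀ δ > 0, ∀ᶠ k in atTop,
      fk k a ≠ ⊤ ∧ |(fk k a).toReal - (f a).toReal| < δ := by
    intro a ha δ hδ
    have h1 : ∀ᶠ k in atTop, fk k a < ⊤ :=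
      (hconv a).eventually_lt_const (lt_top_iff_ne_top.2 ha)
    have h2 := (EReal.tendsto_toReal ha (hf.ne_bot a)).comp (hconv a)
    have h3 := (Metric.tendsto_nhds.1 h2) δ hδ
    filter_upwards [h1, h3] with k hk hk3
    exact ⟨hk.ne, hk3⟩
  refine hK.induction_on (p := fun S => ∃ N : ℕ, ∀ k ≥ N, ∀ a ∈ S,
        fk k a ≠ ⊤ ∧ |(fk k a).toReal - (f a).toReal| ≤ ε) ?_ ?_ ?_ ?_
  · exact ⟨0, by simp⟩
  · rintro s t hst ⟨N, hN⟩
    exact ⟨N, fun k hk a ha => hN k hk a (hst ha)⟩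
  · rintro s t ⟨N, hN⟩ ⟨N', hN'⟩
    refine ⟨max N N', fun k hk a ha => ?_⟩
    rcases ha with ha | ha
    · exact hN k (le_of_max_le_left hk) a ha
    · exact hN' k (le_of_max_le_right hk) a ha
  · intro x hx
    obtain ⟨r', hr', hball⟩ := Metric.mem_nhds_iff.1 (mem_interior_iff_mem_nhds.1 (hKi hx))
    set r := r' / 2 with hr
    have r0 : 0 < r := by positivity
    have fx : f x ≠ ⊤ := hball (Metric.mem_ball_self hr')
    have fp : f (x + r) ≠ ⊤ := hball (by
      rw [Metric.mem_ball, Real.dist_eq, add_sub_cancel_left, abs_of_pos r0]; linarith)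
    have fm : f (x - r) ≠ ⊤ := hball (by
      rw [Metric.mem_ball, Real.dist_eq, sub_sub_cancel_left, abs_neg, abs_of_pos r0]; linarith)
    set M := |(f x).toReal| + |(f (x + r)).toReal| + |(f (x - r)).toReal| + 1 with hM
    have n1 := abs_nonneg (f x).toReal
    have n2 := abs_nonneg (f (x + r)).toReal
    have n3 := abs_nonneg (f (x - r)).toReal
    have M0 : 0 < M := by positivity
    set s := min (1 / 2) (ε / (8 * M)) with hs
    have s0 : 0 < s := by positivity
    have s1 : s < 1 := (min_le_left _ _).trans_lt (by norm_num)
    have s2 : 8 * M * s ≤ ε := by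
      have : s ≤ ε / (8 * M) := min_le_right _ _
      rw [le_div_iff₀ (by positivity)] at this
      linarith
    refine ⟨Metric.closedBall x (s * r),
      mem_nhdsWithin_of_mem_nhds (Metric.closedBall_mem_nhds _ (by positivity)), ?_⟩
    obtain ⟨N, hN⟩ := eventually_atTop.1 (((ev x fx 1 one_pos).and (ev x fx (ε / 2) (by positivity))).and
      ((ev _ fp 1 one_pos).and (ev _ fm 1 one_pos)))
    refine ⟨N, fun k hk y hy => ?_⟩
    obtain ⟨⟨⟨a1, a2⟩, -, a3⟩, ⟨b1, b2⟩, c1, c2⟩ := hN k hk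
    rw [Metric.mem_closedBall, Real.dist_eq] at hy
    have t1 := abs_sub_abs_le_abs_sub (fk k x).toReal (f x).toReal
    have t2 := abs_sub_abs_le_abs_sub (fk k (x + r)).toReal (f (x + r)).toReal
    have t3 := abs_sub_abs_le_abs_sub (fk k (x - r)).toReal (f (x - r)).toReal
    obtain ⟨u1, u2⟩ := local_bd' hf (M := M) r0 s1 fx fp fm (by linarith) (by linarith)
      (by linarith) hy
    obtain ⟨v1, v2⟩ := local_bd' (hfk k) (M := M) r0 s1 a1 b1 c1 (by linarith) (by linarith)
      (by linarith) hy
    refine ⟨v1, ?_⟩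
    rw [abs_le] at u2 v2 ⊢
    rw [abs_lt] at a3
    constructor <;> linarith [u2.1, u2.2, v2.1, v2.2, a3.1, a3.2]
end
end

section
/- Let f, f_k : ℝ → ℝ ∪ {+∞} be proper, lower semicontinuous, convex functions with the effective domain f^{-1}(ℝ) of f not a singleton, and suppose f_k(a) → f(a) for every a ∈ ℝ (convergence in ℝ ∪ {+∞}). Set b⁺ := sup{b ∈ ℝ : f*(b) < +∞} and b⁻ := inf{b ∈ ℝ : f*(b) < +∞}. Then f_k*(b) → f*(b) (in ℝ ∪ {+∞}) for every b ∈ ℝ with b ≠ b⁺ and b ≠ b⁻. -/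
open MeasureTheory Filter Set Topology

noncomputable section

/-- Real-valued form of (tilted) convexity. -/
theorem cvx_real {f : ℝ → EReal} (hf : ProperConvex f) (b x y z A B C t : ℝ)
    (h0 : 0 ≤ t) (h1 : t ≤ 1) (hz : z = t * x + (1 - t) * y)
    (hx : f x ≤ ((A + b * x : ℝ) : EReal)) (hy : f y ≤ ((B + b * y : ℝ) : EReal))
    (hC : t * A + (1 - t) * B ≤ C) :
    f z ≤ ((C + b * z : ℝ) : EReal) := by
  rcases h0.eq_or_lt with rfl | h0
  · simp at hz hC
    subst hz
    refine hy.trans (EReal.coe_le_coe_iff.2 (by linarith))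
  rcases h1.eq_or_lt with rfl | h1
  · simp at hz hC
    subst hz
    refine hx.trans (EReal.coe_le_coe_iff.2 (by linarith))
  have h := hf.convex x y t h0 h1
  rw [← hz] at h
  refine h.trans ?_
  lift f x to ℝ using ⟨ne_top_of_le_ne_top (EReal.coe_ne_top _) hx, hf.ne_bot x⟩ with u
  lift f y to ℝ using ⟨ne_top_of_le_ne_top (EReal.coe_ne_top _) hy, hf.ne_bot y⟩ with v
  rw [EReal.coe_le_coe_iff] at hx hy
  have e : (t : EReal) * (u : EReal) + (1 - (t : EReal)) * (v : EReal)
      = ((t * u + (1 - t) * v : ℝ) : EReal) := by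
    push_cast
    rfl
  rw [e, EReal.coe_le_coe_iff, hz]
  have := mul_le_mul_of_nonneg_left hx h0.le
  have := mul_le_mul_of_nonneg_left hy (sub_nonneg.2 h1.le)
  linarith

theorem conj_low {f : ℝ → EReal} {c K : ℝ} (h : conj f c ≤ (K : EReal)) (x A : ℝ)
    (hx : f x ≤ (A : EReal)) : c * x - K ≤ A := by
  have h1 : ((x * c : ℝ) : EReal) - f x ≤ K := (le_iSup (fun a : ℝ => ((a * c : ℝ) : EReal) - f a) x).trans h
  have h2 : ((x * c : ℝ) : EReal) - (A : EReal) ≤ ((x * c : ℝ) : EReal) - f x :=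
    EReal.sub_le_sub le_rfl hx
  have h3 := h2.trans h1
  rw [← EReal.coe_sub, EReal.coe_le_coe_iff] at h3
  linarith

theorem upper_part (f : ℝ → EReal) (fk : ℕ → ℝ → EReal)
    (hfk : ∀ k, ProperConvex (fk k))
    (hconv : ∀ a : ℝ, Tendsto (fun k => fk k a) atTop (𝓝 (f a)))
    (b c1 c2 K1 K2 s s' a0 b0 A0 B0 : ℝ) (hab : a0 < b0) (hc1 : c1 < b) (hc2 : b < c2)
    (h1 : conj f c1 ≤ (K1 : EReal)) (h2 : conj f c2 ≤ (K2 : EReal)) (hs : conj f b ≤ (s : EReal))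
    (hss : s < s') (hA : f a0 < (A0 : EReal)) (hB : f b0 < (B0 : EReal)) :
    ∀ᶠ k in atTop, ∀ x : ℝ, ¬ fk k x ≤ ((-s' + b * x : ℝ) : EReal) := by
  obtain ⟨B, hB1, hB2, hB3, hB4⟩ : ∃ B : ℝ, A0 ≤ B + b * a0 ∧ B0 ≤ B + b * b0 ∧ 1 - s' ≤ B ∧ -s ≤ B := by
    refine ⟨max (max (A0 - b * a0) (B0 - b * b0)) (max (1 - s') (-s)), ?_, ?_, ?_, ?_⟩
    · have := (le_max_left (A0 - b * a0) (B0 - b * b0)).trans (le_max_left _ (max (1 - s') (-s)))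
      linarith
    · have := (le_max_right (A0 - b * a0) (B0 - b * b0)).trans (le_max_left _ (max (1 - s') (-s)))
      linarith
    · simp
    · simp
  -- far points
  obtain ⟨q, hq, hq'⟩ : ∃ q, b0 < q ∧ B + K2 < (c2 - b) * q := by
    have h := (tendsto_id.const_mul_atTop (sub_pos.2 hc2) : Tendsto (fun x : ℝ => (c2 - b) * id x) atTop atTop)
    exact ((eventually_gt_atTop b0).and (h.eventually_gt_atTop (B + K2))).exists
  obtain ⟨p, hp, hp'⟩ : ∃ p, p < a0 ∧ B + K1 < (c1 - b) * p := by
    have h := (tendsto_id.const_mul_atBot_of_neg (sub_neg.2 hc1) : Tendsto (fun x : ℝ => (c1 - b) * id x) atBot atTop)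
    exact ((eventually_lt_atBot a0).and (h.eventually_gt_atTop (B + K1))).exists
  have hfq : ((B + b * q : ℝ) : EReal) < f q := by
    by_contra hh
    have := conj_low h2 q _ (not_lt.1 hh)
    linarith
  have hfp : ((B + b * p : ℝ) : EReal) < f p := by
    by_contra hh
    have := conj_low h1 p _ (not_lt.1 hh)
    linarith
  have ea := (tendsto_order.1 (hconv a0)).2 _ hA
  have eb := (tendsto_order.1 (hconv b0)).2 _ hB
  have ep := (tendsto_order.1 (hconv p)).1 _ hfp
  have eq := (tendsto_order.1 (hconv q)).1 _ hfq
  obtain ⟨δ, hδ0, hδ1, hδ⟩ : ∃ δ : ℝ, 0 < δ ∧ δ < 1 ∧ (1 - δ) * (-s') + δ * B < -s := by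
    have hD : 0 < B + s' := by linarith
    refine ⟨(s' - s) / (2 * (B + s')), by apply div_pos <;> linarith, ?_, ?_⟩
    · rw [div_lt_one (by linarith)]
      linarith
    · have : (s' - s) / (2 * (B + s')) * (B + s') = (s' - s) / 2 := by
        field_simp
      linarith
  -- near points
  have near : ∀ x ∈ Icc p q, ∀ᶠ w : ℕ × ℝ in atTop ×ˢ 𝓝 x,
      ¬ fk w.1 w.2 ≤ ((-s' + b * w.2 : ℝ) : EReal) := by
    intro x _
    set z := (1 - δ) * x + δ * ((a0 + b0) / 2) with hz
    have hfz : ((((1 - δ) * (-s') + δ * B) + b * z : ℝ) : EReal) < f z := by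
      by_contra hh
      have := conj_low hs z _ (not_lt.1 hh)
      linarith
    have ez := (tendsto_order.1 (hconv z)).1 _ hfz
    have hcont : Tendsto (fun x' => (z - (1 - δ) * x') / δ) (𝓝 x) (𝓝 ((a0 + b0) / 2)) := by
      have : Continuous (fun x' : ℝ => (z - (1 - δ) * x') / δ) := by fun_prop
      have h := this.tendsto x
      have e : (z - (1 - δ) * x) / δ = (a0 + b0) / 2 := by
        rw [hz]; field_simp; ring
      rwa [e] at h
    have ey : ∀ᶠ x' in 𝓝 x, (z - (1 - δ) * x') / δ ∈ Icc a0 b0 :=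
      hcont.eventually (Icc_mem_nhds (by linarith) (by linarith))
    filter_upwards [(ea.and (eb.and ez)).prod_mk ey]
    rintro ⟨k, x'⟩ ⟨⟨ha, hb, hzk⟩, hy⟩ hx
    simp only at ha hb hzk hy hx
    refine not_le.2 hzk ?_
    set y := (z - (1 - δ) * x') / δ with hyd
    have hya : fk k y ≤ ((B + b * y : ℝ) : EReal) := by
      refine cvx_real (hfk k) b a0 b0 y B B B ((b0 - y) / (b0 - a0)) ?_ ?_ ?_
        (ha.le.trans (EReal.coe_le_coe_iff.2 hB1)) (hb.le.trans (EReal.coe_le_coe_iff.2 hB2)) ?_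
      · apply div_nonneg <;> linarith [hy.2]
      · rw [div_le_one (by linarith)]; linarith [hy.1]
      · have : b0 - a0 ≠ 0 := by linarith
        field_simp; ring
      · linarith
    refine cvx_real (hfk k) b x' y z (-s') B _ (1 - δ) (by linarith) (by linarith) ?_ hx hya ?_
    · rw [hyd]; field_simp; ring
    · linarith
  have hK : ∀ᶠ k : ℕ in atTop, ∀ x ∈ Icc p q, ¬ fk k x ≤ ((-s' + b * x : ℝ) : EReal) := by
    refine (isCompact_Icc (a := p) (b := q)).induction_on
      (p := fun S => ∀ᶠ k : ℕ in atTop, ∀ x ∈ S, ¬ fk k x ≤ ((-s' + b * x : ℝ) : EReal)) ?_ ?_ ?_ ?_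
    · simp
    · intro S T hST hT
      filter_upwards [hT] with k hk x hx using hk x (hST hx)
    · intro S T hS hT
      filter_upwards [hS, hT] with k h1 h2 x hx
      exact hx.elim (h1 x) (h2 x)
    · intro x hx
      obtain ⟨pa, hpa, pb, hpb, h⟩ := eventually_prod_iff.1 (near x hx)
      refine ⟨{y | pb y}, mem_nhdsWithin_of_mem_nhds hpb, ?_⟩
      filter_upwards [hpa] with k hk y hy using h hk hy
  filter_upwards [hK, ea, eb, ep, eq] with k hk ha hb hpk hqk x hx
  by_cases hxp : x < p
  · refine not_le.2 hpk ?_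
    have hn : a0 - x ≠ 0 := by linarith
    have t0 : 0 ≤ (a0 - p) / (a0 - x) := by apply div_nonneg <;> linarith
    refine cvx_real (hfk k) b x a0 p (-s') B B ((a0 - p) / (a0 - x)) t0 ?_ ?_ hx
      (ha.le.trans (EReal.coe_le_coe_iff.2 hB1)) ?_
    · rw [div_le_one (by linarith)]; linarith
    · field_simp; ring
    · nlinarith
  by_cases hxq : q < x
  · refine not_le.2 hqk ?_
    have hn : x - b0 ≠ 0 := by linarith
    have t0 : 0 ≤ (q - b0) / (x - b0) := by apply div_nonneg <;> linarith
    refine cvx_real (hfk k) b x b0 q (-s') B B ((q - b0) / (x - b0)) t0 ?_ ?_ hx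
      (hb.le.trans (EReal.coe_le_coe_iff.2 hB2)) ?_
    · rw [div_le_one (by linarith)]; linarith
    · field_simp; ring
    · nlinarith
  exact hk x ⟨not_lt.1 hxp, not_lt.1 hxq⟩ hx

/-- If proper lsc convex `f_k → f` pointwise and the effective domain of `f` is not a
singleton, then `f_k*(b) → f*(b)` (in `ℝ ∪ {+∞}`) at every `b` different from the two
exceptional values `b⁺ = sup {b : f*(b) < ∞}` and `b⁻ = inf {b : f*(b) < ∞}`. -/
theorem statement16 (f : ℝ → EReal) (fk : ℕ → ℝ → EReal)
    (hf : ProperConvex f) (hfk : ∀ k, ProperConvex (fk k))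
    (hdom : ∃ a b : ℝ, a ≠ b ∧ f a ≠ ⊤ ∧ f b ≠ ⊤)
    (hconv : ∀ a : ℝ, Tendsto (fun k => fk k a) atTop (𝓝 (f a)))
    (b : ℝ)
    (hbp : (b : EReal) ≠ sSup ((fun c : ℝ => (c : EReal)) '' {c : ℝ | conj f c ≠ ⊤}))
    (hbm : (b : EReal) ≠ sInf ((fun c : ℝ => (c : EReal)) '' {c : ℝ | conj f c ≠ ⊤})) :
    Tendsto (fun k => conj (fk k) b) atTop (𝓝 (conj f b)) := by
  rw [tendsto_order]
  constructor
  · intro u hu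
    obtain ⟨x, hx⟩ := lt_iSup_iff.1 hu
    have ht : Tendsto (fun k => ((x * b : ℝ) : EReal) - fk k x) atTop
        (𝓝 (((x * b : ℝ) : EReal) - f x)) := by
      simp only [sub_eq_add_neg]
      have hc : ContinuousAt (fun p : EReal × EReal => p.1 + p.2) (((x * b : ℝ) : EReal), - f x) :=
        EReal.continuousAt_add (Or.inl (EReal.coe_ne_top _)) (Or.inl (EReal.coe_ne_bot _))
      exact hc.tendsto.comp (tendsto_const_nhds.prodMk_nhds ((continuous_neg.tendsto _).comp (hconv x)))
    filter_upwards [(tendsto_order.1 ht).1 u hx] with k hk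
    exact hk.trans_le (le_iSup (fun a : ℝ => ((a * b : ℝ) : EReal) - fk k a) x)
  · intro u hu
    have hbt : conj f b ≠ ⊤ := hu.ne_top
    obtain ⟨s', hs1, hs2⟩ := EReal.lt_iff_exists_real_btwn.1 hu
    obtain ⟨s, hs3, hs4⟩ := EReal.lt_iff_exists_real_btwn.1 hs1
    have m1 := lt_of_le_of_ne (le_sSup (mem_image_of_mem (fun c : ℝ => (c : EReal))
      (show b ∈ {c : ℝ | conj f c ≠ ⊤} from hbt))) hbp
    have m2 := lt_of_le_of_ne (sInf_le (mem_image_of_mem (fun c : ℝ => (c : EReal))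
      (show b ∈ {c : ℝ | conj f c ≠ ⊤} from hbt))) hbm.symm
    obtain ⟨_, ⟨c2, hc2, rfl⟩, hbc2⟩ := lt_sSup_iff.1 m1
    obtain ⟨_, ⟨c1, hc1, rfl⟩, hbc1⟩ := sInf_lt_iff.1 m2
    obtain ⟨a0, b0, hab, ha, hb⟩ : ∃ a b : ℝ, a < b ∧ f a ≠ ⊤ ∧ f b ≠ ⊤ := by
      obtain ⟨a, b, hne, ha, hb⟩ := hdom
      rcases lt_or_gt_of_ne hne with h | h
      · exact ⟨a, b, h, ha, hb⟩
      · exact ⟨b, a, h, hb, ha⟩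
    obtain ⟨A0, hA0, -⟩ := EReal.lt_iff_exists_real_btwn.1 (lt_top_iff_ne_top.2 ha)
    obtain ⟨B0, hB0, -⟩ := EReal.lt_iff_exists_real_btwn.1 (lt_top_iff_ne_top.2 hb)
    have key := upper_part f fk hfk hconv b c1 c2 _ _ s s' a0 b0 A0 B0 hab
      (EReal.coe_lt_coe_iff.1 hbc1) (EReal.coe_lt_coe_iff.1 hbc2) (EReal.le_coe_toReal hc1)
      (EReal.le_coe_toReal hc2) hs3.le (EReal.coe_lt_coe_iff.1 hs4) hA0 hB0
    filter_upwards [key] with k hk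
    refine lt_of_le_of_lt (iSup_le fun x => ?_) hs2
    have h := EReal.sub_le_sub (le_refl ((x * b : ℝ) : EReal)) (not_le.1 (hk x)).le
    refine h.trans ?_
    rw [← EReal.coe_sub, EReal.coe_le_coe_iff]
    linarith
end
end

section
/- Let f, f_k : ℝ → ℝ ∪ {+∞} be proper, lower semicontinuous, convex functions with the effective domain f^{-1}(ℝ) of f not a singleton, and suppose f_k(a) → f(a) for every a ∈ ℝ (convergence in ℝ ∪ {+∞}). If f* is differentiable at a point b ∈ ℝ (with finite derivative (f*)′(b)), then for every ε > 0 there exists N such that for all k ≥ N the subdifferential ∂f_k*(b) is nonempty and contained in [(f*)′(b) − ε, (f*)′(b) + ε]. Moreover, f_k* converges to f* uniformly on every compact subset of the interior of (f*)^{-1}(ℝ). -/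
open MeasureTheory Filter Set Topology

noncomputable section

theorem conj_le_iff (f : ℝ → EReal) (b M : ℝ) :
    conj f b ≤ (M : EReal) ↔ ∀ a r : ℝ, f a ≤ (r : EReal) → a * b - r ≤ M := by
  unfold conj
  rw [iSup_le_iff]
  refine forall_congr' fun a => ?_
  induction h : f a with
  | bot =>
    constructor
    · intro h; rw [EReal.coe_sub_bot] at h; exact absurd h (not_le.2 (EReal.coe_lt_top M))
    · intro h; have := h (a * b - M - 1) bot_le; linarith
  | top => simp
  | coe v =>
    constructor
    · intro h r hr
      norm_cast at h hr
      linarith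
    · intro h
      have := h v le_rfl
      exact_mod_cast this

theorem conj_ne_bot {f : ℝ → EReal} (hf : ∃ a, f a ≠ ⊤) (b : ℝ) : conj f b ≠ ⊥ := by
  obtain ⟨a, ha⟩ := hf
  intro h
  have h1 : f a ≤ ((f a).toReal : EReal) := EReal.le_coe_toReal ha
  have := (conj_le_iff f b (a * b - (f a).toReal - 1)).1 (h ▸ bot_le) a _ h1
  linarith

theorem convexE_epi {f : ℝ → EReal} (hf : ConvexE f) {x y r s t : ℝ} (h0 : 0 < t) (h1 : t < 1)
    (hx : f x ≤ (r : EReal)) (hy : f y ≤ (s : EReal)) :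
    f (t * x + (1 - t) * y) ≤ ((t * r + (1 - t) * s : ℝ) : EReal) := by
  refine (hf x y t h0 h1).trans ?_
  have e : ((1 - t : ℝ) : EReal) = (1 : EReal) - (t : EReal) := by norm_cast
  rw [← e, EReal.coe_add, EReal.coe_mul, EReal.coe_mul]
  refine add_le_add ?_ ?_
  · exact mul_le_mul_of_nonneg_left hx (by exact_mod_cast h0.le)
  · exact mul_le_mul_of_nonneg_left hy (by exact_mod_cast (sub_pos.2 h1).le)

theorem conj_convexOn {f : ℝ → EReal} (hf : ∃ a, f a ≠ ⊤) :
    ConvexOn ℝ {b : ℝ | conj f b ≠ ⊤} (fun b => (conj f b).toReal) := by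
  have key : ∀ x y u v : ℝ, conj f x ≠ ⊤ → conj f y ≠ ⊤ → 0 ≤ u → 0 ≤ v → u + v = 1 →
      conj f (u * x + v * y) ≤ ((u * (conj f x).toReal + v * (conj f y).toReal : ℝ) : EReal) := by
    intro x y u v hx hy hu hv huv
    rw [conj_le_iff]
    intro a r har
    have h1 := (conj_le_iff f x _).1 (EReal.le_coe_toReal hx) a r har
    have h2 := (conj_le_iff f y _).1 (EReal.le_coe_toReal hy) a r har
    have h3 := mul_le_mul_of_nonneg_left h1 hu
    have h4 := mul_le_mul_of_nonneg_left h2 hv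
    have h5 : r = (u + v) * r := by rw [huv, one_mul]
    linarith
  constructor
  · intro x hx y hy u v hu hv huv
    exact ne_top_of_le_ne_top (EReal.coe_ne_top _) (key x y u v hx hy hu hv huv)
  · intro x hx y hy u v hu hv huv
    have := key x y u v hx hy hu hv huv
    have h2 := EReal.toReal_le_toReal this (conj_ne_bot hf _) (EReal.coe_ne_top _)
    rw [EReal.toReal_coe] at h2
    simpa only [smul_eq_mul] using h2

theorem conj_lower {f : ℝ → EReal} {fk : ℕ → ℝ → EReal}
    (hconv : ∀ a : ℝ, Tendsto (fun k => fk k a) atTop (𝓝 (f a))) (b c : ℝ)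
    (h : (c : EReal) < conj f b) : ∀ᶠ k in atTop, (c : EReal) < conj (fk k) b := by
  obtain ⟨d, hcd, hd⟩ := EReal.lt_iff_exists_real_btwn.1 h
  have hcd' : c < d := by exact_mod_cast hcd
  rw [← not_le, conj_le_iff] at hd
  push Not at hd
  obtain ⟨a, r, har, hr⟩ := hd
  have h1 : f a < ((r + (d - c) : ℝ) : EReal) :=
    lt_of_le_of_lt har (by exact_mod_cast (by linarith))
  filter_upwards [(hconv a).eventually_lt_const h1] with k hk
  rw [← not_le, conj_le_iff]
  push Not
  exact ⟨a, _, hk.le, by linarith⟩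

theorem grid_point {η u v : ℝ} (hη : 0 < η) (h : u + η ≤ v) : ∃ j : ℤ, u < j * η ∧ j * η ≤ v := by
  refine ⟨⌊u / η⌋ + 1, ?_, ?_⟩
  · have := Int.lt_floor_add_one (u / η)
    rw [div_lt_iff₀ hη] at this
    push_cast; exact this
  · have := Int.floor_le (u / η)
    rw [le_div_iff₀ hη] at this
    push_cast; linarith

theorem conj_upper {f : ℝ → EReal} {fk : ℕ → ℝ → EReal}
    (hfk : ∀ k, ConvexE (fk k))
    (hdom : ∃ a b : ℝ, a ≠ b ∧ f a ≠ ⊤ ∧ f b ≠ ⊤)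
    (hconv : ∀ a : ℝ, Tendsto (fun k => fk k a) atTop (𝓝 (f a))) (b : ℝ)
    (hb : b ∈ interior {b : ℝ | conj f b ≠ ⊤}) (ε : ℝ) (hε : 0 < ε) :
    ∀ᶠ k in atTop, conj (fk k) b ≤ (((conj f b).toReal + ε : ℝ) : EReal) := by
  obtain ⟨p, q, hpq, hp, hq⟩ : ∃ p q : ℝ, p < q ∧ f p ≠ ⊤ ∧ f q ≠ ⊤ := by
    obtain ⟨p, q, h, hp, hq⟩ := hdom
    rcases lt_or_gt_of_ne h with h | h
    · exact ⟨p, q, h, hp, hq⟩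
    · exact ⟨q, p, h, hq, hp⟩
  obtain ⟨δ, hδ, hball⟩ := Metric.mem_nhds_iff.1 (mem_interior_iff_mem_nhds.1 hb)
  have hmem : ∀ x, |x - b| < δ → conj f x ≠ ⊤ := fun x hx => hball (by simpa [Real.dist_eq] using hx)
  have hb0 := (conj_le_iff f b _).1 (EReal.le_coe_toReal (hmem b (by simpa using hδ)))
  have hb1 := (conj_le_iff f (b + δ / 2) _).1 (EReal.le_coe_toReal (hmem (b + δ / 2)
    (by rw [abs_lt]; constructor <;> linarith)))
  have hb2 := (conj_le_iff f (b - δ / 2) _).1 (EReal.le_coe_toReal (hmem (b - δ / 2)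
    (by rw [abs_lt]; constructor <;> linarith)))
  generalize (conj f b).toReal = m at *
  generalize (conj f (b + δ / 2)).toReal = M1 at *
  generalize (conj f (b - δ / 2)).toReal = M2 at *
  have hP := EReal.le_coe_toReal hp
  have hQ := EReal.le_coe_toReal hq
  generalize (f p).toReal = P at *
  generalize (f q).toReal = Q at *
  obtain ⟨C, hC1, hC2⟩ : ∃ C, P + 1 - p * b ≤ C ∧ Q + 1 - q * b ≤ C :=
    ⟨max _ _, le_max_left _ _, le_max_right _ _⟩
  have hmP := hb0 p P hP
  have hCm : 1 ≤ C + m := by linarith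
  obtain ⟨R, hR1, hR2, hR3, hR4⟩ : ∃ R : ℝ, |p| < R ∧ |q| < R ∧ M1 + C < δ / 2 * R ∧
      M2 + C < δ / 2 * R := by
    have hδ2 : 0 < δ / 2 := by linarith
    refine ((eventually_gt_atTop |p|).and ((eventually_gt_atTop |q|).and
      (((tendsto_id.const_mul_atTop hδ2).eventually_gt_atTop (M1 + C)).and
      ((tendsto_id.const_mul_atTop hδ2).eventually_gt_atTop (M2 + C))))).exists
  rw [abs_lt] at hR1 hR2
  have hRp : ((R * b + C : ℝ) : EReal) < f R := by
    by_contra h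
    have := hb1 R _ (not_lt.1 h)
    linarith
  have hRn : ((-R * b + C : ℝ) : EReal) < f (-R) := by
    by_contra h
    have := hb2 (-R) _ (not_lt.1 h)
    linarith
  obtain ⟨t, ht0, ht1, htC⟩ : ∃ t : ℝ, 0 < t ∧ t < 1 ∧ t * (C + m + ε) = ε / 2 := by
    have h0 : 0 < C + m + ε := by linarith
    refine ⟨ε / 2 / (C + m + ε), by positivity, ?_, by field_simp⟩
    rw [div_lt_one h0]; linarith
  obtain ⟨η, hη⟩ : ∃ η, η = t * ((q - p) / 2) := ⟨_, rfl⟩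
  have hη0 : 0 < η := by rw [hη]; have := sub_pos.2 hpq; positivity
  obtain ⟨n, hn⟩ := exists_nat_ge (R / η)
  rw [div_le_iff₀ hη0] at hn
  have hgrid : ∀ᶠ k in atTop, ∀ j ∈ Finset.Icc (-(n : ℤ)) n,
      ((j * η * b - m - ε / 2 : ℝ) : EReal) < fk k (j * η) := by
    rw [eventually_all_finset]
    intro j _
    refine (hconv _).eventually_const_lt ?_
    by_contra h
    have := hb0 _ _ (not_lt.1 h)
    linarith
  have hPk : f p < ((P + 1 : ℝ) : EReal) := lt_of_le_of_lt hP (by exact_mod_cast (by linarith))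
  have hQk : f q < ((Q + 1 : ℝ) : EReal) := lt_of_le_of_lt hQ (by exact_mod_cast (by linarith))
  filter_upwards [hgrid, (hconv p).eventually_lt_const hPk, (hconv q).eventually_lt_const hQk,
    (hconv R).eventually_const_lt hRp, (hconv (-R)).eventually_const_lt hRn] with k hG hp' hq' h1 h2
  have hpC : fk k p ≤ ((p * b + C : ℝ) : EReal) := hp'.le.trans (by exact_mod_cast (by linarith))
  have hqC : fk k q ≤ ((q * b + C : ℝ) : EReal) := hq'.le.trans (by exact_mod_cast (by linarith))
  rw [conj_le_iff]
  intro a r har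
  -- points beyond a barrier
  have far : ∀ S : ℝ, ((S * b + C : ℝ) : EReal) < fk k S → 0 < (S - p) * (a - S) →
      a * b - r ≤ m + ε := by
    intro S hS hpos
    obtain ⟨s, hs0, hs1, hsS⟩ : ∃ s : ℝ, 0 < s ∧ s < 1 ∧ s * a + (1 - s) * p = S := by
      have hne : a - p ≠ 0 := by
        intro h
        have : (S - p) * (a - S) = - (S - p) ^ 2 := by
          have : a = p := by linarith
          rw [this]; ring
        nlinarith [sq_nonneg (S - p)]
      refine ⟨(S - p) / (a - p), ?_, ?_, by field_simp; ring⟩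
      · rcases pos_and_pos_or_neg_and_neg_of_mul_pos hpos with h | h
        · exact div_pos h.1 (by linarith)
        · exact div_pos_of_neg_of_neg h.1 (by linarith)
      · rcases pos_and_pos_or_neg_and_neg_of_mul_pos hpos with h | h
        · rw [div_lt_one (by linarith)]; linarith
        · rw [div_lt_one_of_neg (by linarith)]; linarith
    have := hS.trans_le (hsS ▸ convexE_epi (hfk k) hs0 hs1 har hpC)
    have h3 : S * b + C < s * r + (1 - s) * (p * b + C) := by exact_mod_cast this
    rw [← hsS] at h3
    have h4 : 0 < s * (r - a * b - C) := by linarith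
    have h5 := (pos_iff_pos_of_mul_pos h4).1 hs0
    linarith
  rcases lt_or_ge R a with hRa | hRa
  · exact far R h1 (mul_pos (by linarith) (by linarith))
  rcases lt_or_ge a (-R) with hRa' | hRa'
  · exact far (-R) h2 (mul_pos_of_neg_of_neg (by linarith) (by linarith))
  by_contra hcon
  push Not at hcon
  have har' : fk k a ≤ ((a * b - m - ε : ℝ) : EReal) := har.trans (by exact_mod_cast (by linarith))
  have near : ∀ e s : ℝ, fk k e ≤ ((e * b + C : ℝ) : EReal) → 0 < s → s ≤ t →
      fk k (s * e + (1 - s) * a) ≤ (((s * e + (1 - s) * a) * b - m - ε / 2 : ℝ) : EReal) := by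
    intro e s he hs hst
    refine (convexE_epi (hfk k) hs (hst.trans_lt ht1) he har').trans ?_
    norm_cast
    have : s * (C + m + ε) ≤ t * (C + m + ε) := mul_le_mul_of_nonneg_right hst (by linarith)
    linarith
  have fin : ∀ j : ℤ, ∀ e s : ℝ, fk k e ≤ ((e * b + C : ℝ) : EReal) → 0 < s → s ≤ t →
      |j * η| ≤ R → s * e + (1 - s) * a = j * η → False := by
    intro j e s he hs hst hj hse
    have h3 := near e s he hs hst
    rw [hse] at h3
    refine absurd (hG j ?_) (not_lt.2 h3)
    rw [abs_le] at hj
    have h4 : (j : ℝ) ≤ n := le_of_mul_le_mul_right (by linarith) hη0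
    have h5 : -(n : ℝ) ≤ j := le_of_mul_le_mul_right (by linarith) hη0
    rw [Finset.mem_Icc]
    exact ⟨by exact_mod_cast h5, by exact_mod_cast h4⟩
  rcases le_total a ((p + q) / 2) with hmid | hmid
  · have hqa : 0 < q - a := by linarith
    have hle : η ≤ t * (q - a) := by rw [hη]; exact mul_le_mul_of_nonneg_left (by linarith) ht0.le
    have hle2 : t * (q - a) ≤ q - a := by nlinarith
    obtain ⟨j, hj1, hj2⟩ := grid_point (u := a) (v := a + t * (q - a)) hη0 (by linarith)
    refine fin j q ((j * η - a) / (q - a)) hqC (div_pos (by linarith) hqa) ?_ ?_ ?_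
    · rw [div_le_iff₀ hqa]; linarith
    · rw [abs_le]; constructor <;> linarith
    · field_simp; ring
  · have hqa : 0 < a - p := by linarith
    have hle : η ≤ t * (a - p) := by rw [hη]; exact mul_le_mul_of_nonneg_left (by linarith) ht0.le
    have hle2 : t * (a - p) ≤ a - p := by nlinarith
    obtain ⟨j, hj1, hj2⟩ := grid_point (u := -a) (v := -a + t * (a - p)) hη0 (by linarith)
    refine fin (-j) p ((a + j * η) / (a - p)) hpC (div_pos (by linarith) hqa) ?_ ?_ ?_
    · rw [div_le_iff₀ hqa]; linarith
    · push_cast; rw [abs_le]; constructor <;> linarith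
    · push_cast; field_simp; ring

theorem conj_close {f : ℝ → EReal} {fk : ℕ → ℝ → EReal}
    (hf : ∃ a, f a ≠ ⊤) (hfp : ∀ k, ∃ a, fk k a ≠ ⊤)
    (hfk : ∀ k, ConvexE (fk k))
    (hdom : ∃ a b : ℝ, a ≠ b ∧ f a ≠ ⊤ ∧ f b ≠ ⊤)
    (hconv : ∀ a : ℝ, Tendsto (fun k => fk k a) atTop (𝓝 (f a))) (b : ℝ)
    (hb : b ∈ interior {b : ℝ | conj f b ≠ ⊤}) (ε : ℝ) (hε : 0 < ε) :
    ∀ᶠ k in atTop, conj (fk k) b ≠ ⊤ ∧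
      |(conj (fk k) b).toReal - (conj f b).toReal| ≤ ε := by
  have hbt : conj f b ≠ ⊤ := interior_subset hb
  have hlt : (((conj f b).toReal - ε : ℝ) : EReal) < conj f b := by
    conv_rhs => rw [← EReal.coe_toReal hbt (conj_ne_bot hf b)]
    exact_mod_cast (by linarith)
  filter_upwards [conj_upper hfk hdom hconv b hb ε hε, conj_lower hconv b _ hlt] with k h1 h2
  have ht : conj (fk k) b ≠ ⊤ := ne_top_of_le_ne_top (EReal.coe_ne_top _) h1
  rw [← EReal.coe_toReal ht (conj_ne_bot (hfp k) b)] at h1 h2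
  norm_cast at h1 h2
  refine ⟨ht, ?_⟩
  rw [abs_le]; constructor <;> linarith

/-- If proper lsc convex `f_k → f` pointwise and the effective domain of `f` is not a
singleton, then: wherever `f*` is differentiable with finite derivative `L`, for large `k`
the subdifferentials `∂f_k*(b)` are nonempty and contained in `[L - ε, L + ε]`; moreover
`f_k* → f*` uniformly on compact subsets of the interior of the domain of `f*`. -/
theorem statement17 (f : ℝ → EReal) (fk : ℕ → ℝ → EReal)
    (hf : ProperConvex f) (hfk : ∀ k, ProperConvex (fk k))
    (hdom : ∃ a b : ℝ, a ≠ b ∧ f a ≠ ⊤ ∧ f b ≠ ⊤)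
    (hconv : ∀ a : ℝ, Tendsto (fun k => fk k a) atTop (𝓝 (f a))) :
    (∀ b L : ℝ, (∀ᶠ x in 𝓝 b, conj f x ≠ ⊤) →
      HasDerivAt (fun x => (conj f x).toReal) L b →
      ∀ ε : ℝ, 0 < ε → ∃ N : ℕ, ∀ k ≥ N,
        (subdiff (conj (fk k)) b).Nonempty ∧
        subdiff (conj (fk k)) b ⊆ Set.Icc (L - ε) (L + ε)) ∧
    (∀ K : Set ℝ, IsCompact K → K ⊆ interior {b : ℝ | conj f b ≠ ⊤} →
      ∀ ε : ℝ, 0 < ε → ∃ N : ℕ, ∀ k ≥ N, ∀ b ∈ K,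
        conj (fk k) b ≠ ⊤ ∧ |(conj (fk k) b).toReal - (conj f b).toReal| ≤ ε) := by
  have hcl := fun b hb ε hε => conj_close hf.proper (fun k => (hfk k).proper)
    (fun k => (hfk k).convex) hdom hconv b hb ε hε
  constructor
  · intro b L hnb hder ε hε
    have hb : b ∈ interior {b : ℝ | conj f b ≠ ⊤} := mem_interior_iff_mem_nhds.2 hnb
    -- difference quotients
    have hq : ∀ᶠ x in 𝓝[≠] b, |slope (fun x => (conj f x).toReal) b x - L| < ε / 2 := by
      have := (hasDerivAt_iff_tendsto_slope.1 hder)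
      have := Metric.tendsto_nhds.1 this (ε / 2) (by linarith)
      simpa [Real.dist_eq] using this
    have hint : ∀ᶠ x in 𝓝 b, x ∈ interior {b : ℝ | conj f b ≠ ⊤} :=
      isOpen_interior.mem_nhds hb
    rw [eventually_nhdsWithin_iff] at hq
    obtain ⟨δ, hδ, hball⟩ := Metric.eventually_nhds_iff.1 (hq.and hint)
    obtain ⟨s, hs⟩ : ∃ s, s = δ / 2 := ⟨_, rfl⟩
    have hs0 : 0 < s := by linarith
    obtain ⟨hp1, hp2⟩ := @hball (b + s) (by rw [Real.dist_eq, abs_lt]; constructor <;> linarith)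
    obtain ⟨hn1, hn2⟩ := @hball (b - s) (by rw [Real.dist_eq, abs_lt]; constructor <;> linarith)
    have hp1 := hp1 (by simp; exact hs0.ne')
    have hn1 := hn1 (by simp; exact hs0.ne')
    rw [slope_def_field, abs_lt] at hp1 hn1
    have hs4 : 0 < ε / 4 * s := by positivity
    obtain ⟨N, hN⟩ := eventually_atTop.1 ((hcl b hb _ hs4).and
      ((hcl _ hp2 _ hs4).and (hcl _ hn2 _ hs4)))
    refine ⟨N, fun k hk => ?_⟩
    obtain ⟨⟨h0t, h0⟩, ⟨hpt, hp⟩, ⟨hnt, hn⟩⟩ := hN k hk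
    have hcv := conj_convexOn (hfk k).proper
    have hnb : ∀ x, conj (fk k) x ≠ ⊥ := conj_ne_bot (hfk k).proper
    have hbk : b ∈ interior {b : ℝ | conj (fk k) b ≠ ⊤} := by
      rw [mem_interior]
      refine ⟨Ioo (b - s) (b + s), ?_, isOpen_Ioo, by constructor <;> linarith⟩
      exact Ioo_subset_Icc_self.trans (hcv.1.ordConnected.out hnt hpt)
    have hsub : ∀ c x : ℝ, conj (fk k) x ≠ ⊤ →
        (conj (fk k) b + ((c * (x - b) : ℝ) : EReal) ≤ conj (fk k) x ↔
        (conj (fk k) b).toReal + c * (x - b) ≤ (conj (fk k) x).toReal) := by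
      intro c x hx
      conv_lhs => rw [← EReal.coe_toReal h0t (hnb b), ← EReal.coe_toReal hx (hnb x)]
      norm_cast
    constructor
    · refine ⟨derivWithin (fun x => (conj (fk k) x).toReal) (Ioi b) b, fun x => ?_⟩
      by_cases hx : conj (fk k) x = ⊤
      · rw [hx]; exact le_top
      rw [hsub _ _ hx]
      rcases lt_trichotomy x b with h | h | h
      · have h1 := hcv.slope_le_leftDeriv_of_mem_interior hx hbk h
        have h2 := hcv.leftDeriv_le_rightDeriv_of_mem_interior hbk
        have h3 := h1.trans h2
        rw [slope_def_field, div_le_iff₀ (by linarith)] at h3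
        linarith
      · rw [h]; simp
      · have h3 := hcv.rightDeriv_le_slope_of_mem_interior hbk hx h
        rw [slope_def_field, le_div_iff₀ (by linarith)] at h3
        linarith
    · intro c hc
      have c1 := (hsub c _ hpt).1 (hc _)
      have c2 := (hsub c _ hnt).1 (hc _)
      rw [abs_le] at h0 hp hn
      have e1 : b + s - b = s := by ring
      have e2 : b - s - b = -s := by ring
      rw [e1] at hp1 c1
      rw [e2] at hn1 c2
      have d1 := hp1.2
      have d2 := hn1.1
      rw [sub_lt_iff_lt_add, div_lt_iff₀ hs0] at d1
      rw [div_neg, lt_sub_iff_add_lt, lt_neg, div_lt_iff₀ hs0] at d2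
      constructor
      · refine le_of_mul_le_mul_right (a := s) ?_ hs0
        linarith
      · refine le_of_mul_le_mul_right (a := s) ?_ hs0
        linarith
  · intro K hK hKi ε hε
    suffices H : ∀ᶠ k in atTop, ∀ b ∈ K,
        conj (fk k) b ≠ ⊤ ∧ |(conj (fk k) b).toReal - (conj f b).toReal| ≤ ε by
      exact eventually_atTop.1 H
    have hcont := (conj_convexOn hf.proper).continuousOn_interior
    have loc : ∀ b ∈ K, ∃ u ∈ 𝓝[K] b, ∀ᶠ k in atTop, ∀ x ∈ u,
        conj (fk k) x ≠ ⊤ ∧ |(conj (fk k) x).toReal - (conj f x).toReal| ≤ ε := by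
      intro b hbK
      have hb := hKi hbK
      have hc := (hcont b hb).continuousAt (isOpen_interior.mem_nhds hb)
      have hc' := Metric.tendsto_nhds.1 hc (ε / 5) (by linarith)
      have hint : ∀ᶠ x in 𝓝 b, x ∈ interior {b : ℝ | conj f b ≠ ⊤} :=
        isOpen_interior.mem_nhds hb
      obtain ⟨δ, hδ, hball⟩ := Metric.eventually_nhds_iff.1 (hc'.and hint)
      obtain ⟨s, hs⟩ : ∃ s, s = δ / 2 := ⟨_, rfl⟩
      have hs0 : 0 < s := by linarith
      have hB : ∀ x ∈ Icc (b - s) (b + s),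
          |(conj f x).toReal - (conj f b).toReal| < ε / 5 ∧
          x ∈ interior {b : ℝ | conj f b ≠ ⊤} := by
        intro x hx
        refine @hball x ?_
        rw [Real.dist_eq, abs_lt]; constructor <;> linarith [hx.1, hx.2]
      obtain ⟨hp1, hp2⟩ := hB (b + s) (by constructor <;> linarith)
      obtain ⟨hn1, hn2⟩ := hB (b - s) (by constructor <;> linarith)
      refine ⟨Icc (b - s) (b + s), mem_nhdsWithin_of_mem_nhds
        (Icc_mem_nhds (by linarith) (by linarith)), ?_⟩
      have h5 : 0 < ε / 5 := by linarith
      filter_upwards [hcl b hb _ h5, hcl _ hp2 _ h5, hcl _ hn2 _ h5] with k h0 hp hn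
      obtain ⟨h0t, h0⟩ := h0
      obtain ⟨hpt, hp⟩ := hp
      obtain ⟨hnt, hn⟩ := hn
      have hcv := conj_convexOn (hfk k).proper
      rw [abs_le] at h0 hp hn
      rw [abs_lt] at hp1 hn1
      have hup : ∀ x ∈ Icc (b - s) (b + s), conj (fk k) x ≠ ⊤ ∧
          (conj (fk k) x).toReal ≤ (conj f b).toReal + 2 * (ε / 5) := by
        intro x hx
        refine ⟨hcv.1.ordConnected.out hnt hpt hx, ?_⟩
        refine (hcv.le_max_of_mem_Icc hnt hpt hx).trans (max_le ?_ ?_) <;> linarith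
      intro x hx
      have hx2 : 2 * b - x ∈ Icc (b - s) (b + s) := by
        constructor <;> linarith [hx.1, hx.2]
      obtain ⟨hxt, hxu⟩ := hup x hx
      obtain ⟨hyt, hyu⟩ := hup _ hx2
      have hm := hcv.2 hxt hyt (show (0 : ℝ) ≤ 1 / 2 by norm_num)
        (show (0 : ℝ) ≤ 1 / 2 by norm_num) (by norm_num)
      have e : (1 / 2 : ℝ) • x + (1 / 2 : ℝ) • (2 * b - x) = b := by
        simp only [smul_eq_mul]; ring
      simp only [e] at hm
      simp only [smul_eq_mul] at hm
      have hxb := (hB x hx).1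
      rw [abs_lt] at hxb
      refine ⟨hxt, ?_⟩
      rw [abs_le]; constructor <;> linarith
    refine hK.induction_on (p := fun u => ∀ᶠ k in atTop, ∀ x ∈ u,
        conj (fk k) x ≠ ⊤ ∧ |(conj (fk k) x).toReal - (conj f x).toReal| ≤ ε) ?_ ?_ ?_ loc
    · simp
    · intro u v huv hv
      filter_upwards [hv] with k hk x hx using hk x (huv hx)
    · intro u v hu hv
      filter_upwards [hu, hv] with k h1 h2 x hx
      exact hx.elim (h1 x) (h2 x)
end
end

section
/- Let f_k, f : ℝ → ℝ ∪ {+∞} be proper, lower semicontinuous, convex functions with f_k(a) → f(a) for every a ∈ ℝ (convergence in ℝ ∪ {+∞}), and suppose a₀ := inf{a ∈ ℝ : f(a) < +∞} < sup{a ∈ ℝ : f(a) < +∞} =: a₁. Assume f is strictly convex on the interior of its effective domain. Let Q_∞ = [0,∞) × ℝ^d. Let u_k ∈ L¹_loc(Q_∞) be a sequence such that on every compact D ⊂ Q_∞ the family {u_k} is uniformly integrable, and u_k ⇀ u weakly in L¹_loc(Q_∞) for some u ∈ L¹_loc(Q_∞). Suppose furthermore that f_k(u_k) ∈ L¹_loc(Q_∞),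 that f_k(u_k) ⇀ f(u) weakly in L¹_loc(Q_∞), that f(u) ∈ L¹([0,T]×ℝ^d) for every T > 0, and that there exists v ∈ L^∞_loc(Q_∞) with v(t,x) ∈ ∂f(u(t,x)) for almost every (t,x) ∈ Q_∞. Then u_k converges to u locally in measure: for every compact D ⊂ Q_∞ and every ε > 0, the Lebesgue measure of {(t,x) ∈ D : |u_k(t,x) − u(t,x)| > ε} tends to 0 as k → ∞. -/
open MeasureTheory Filter Set Topology

noncomputable section

/-- The spacetime domain `Q_∞ = [0,∞) × ℝ^d`. -/
def Qinf (d : ℕ) : Set (ℝ × (Fin d → ℝ)) := {p | 0 ≤ p.1}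

/-- The spacetime cylinder `[0,T] × ℝ^d`. -/
def QT (d : ℕ) (T : ℝ) : Set (ℝ × (Fin d → ℝ)) :=
  Set.Icc (0:ℝ) T ×ˢ (Set.univ : Set (Fin d → ℝ))

/-- Weak convergence in `L¹_loc(Q_∞)`: integrals against bounded measurable functions
supported in a compact subset of `Q_∞` converge. -/
def WeakL1LocTendsto (d : ℕ) (u : ℕ → ℝ × (Fin d → ℝ) → ℝ)
    (v : ℝ × (Fin d → ℝ) → ℝ) : Prop :=
  ∀ K : Set (ℝ × (Fin d → ℝ)), IsCompact K → K ⊆ Qinf d →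
    ∀ φ : ℝ × (Fin d → ℝ) → ℝ, Measurable φ → (∃ C : ℝ, ∀ p, |φ p| ≤ C) →
      (∀ p, p ∉ K → φ p = 0) →
      Tendsto (fun k => ∫ p in Qinf d, φ p * u k p) atTop
        (𝓝 (∫ p in Qinf d, φ p * v p))

lemma aux_conv_s19 {f : ℝ → EReal} (hf : ProperConvex f) {x y r s t : ℝ}
    (hx : f x ≤ (r : EReal)) (hy : f y ≤ (s : EReal)) (h0 : 0 < t) (h1 : t < 1) :
    f (t * x + (1 - t) * y) ≤ ((t * r + (1 - t) * s : ℝ) : EReal) := by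
  refine (hf.convex x y t h0 h1).trans ?_
  have e : ((1 : EReal) - (t : EReal)) = ((1 - t : ℝ) : EReal) := by norm_cast
  rw [e, EReal.coe_add, EReal.coe_mul, EReal.coe_mul]
  have h2 : (0 : EReal) ≤ (t : EReal) := by exact_mod_cast h0.le
  have h3 : (0 : EReal) ≤ ((1 - t : ℝ) : EReal) := by exact_mod_cast (by linarith : (0:ℝ) ≤ 1 - t)
  exact add_le_add (mul_le_mul_of_nonneg_left hx h2) (mul_le_mul_of_nonneg_left hy h3)

lemma aux_lsc {f : ℝ → EReal} (hf : LowerSemicontinuous f) {w d : ℕ → ℝ} {x e : ℝ}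
    (hw : Tendsto w atTop (𝓝 x)) (hd : Tendsto d atTop (𝓝 e))
    (h : ∀ᶠ n in atTop, f (w n) ≤ (d n : EReal)) : f x ≤ (e : EReal) := by
  by_contra hc
  push Not at hc
  obtain ⟨q, hq1, hq2⟩ := EReal.lt_iff_exists_real_btwn.1 hc
  have h1 := hw.eventually (hf x q hq2)
  have h2 := hd.eventually (gt_mem_nhds (EReal.coe_lt_coe_iff.1 hq1))
  obtain ⟨n, ha, hb, hc⟩ := (h.and (h1.and h2)).exists
  have := hb.trans_le ha
  exact absurd (EReal.coe_lt_coe_iff.1 this) (not_lt.2 hc.le)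

lemma aux_real {f : ℝ → EReal} (hf : ProperConvex f) {a : ℝ} (h : f a ≠ ⊤) :
    f a = ((f a).toReal : EReal) := (EReal.coe_toReal h (hf.ne_bot a)).symm

lemma aux_fk {f : ℝ → EReal} {fk : ℕ → ℝ → EReal}
    (hf : ProperConvex f) (hfk : ∀ k, ProperConvex (fk k))
    (hconv : ∀ a : ℝ, Tendsto (fun k => fk k a) atTop (𝓝 (f a)))
    {k : ℕ → ℕ} (hk : Tendsto k atTop atTop) {z : ℝ} (hz : f z ≠ ⊤) :
    (∀ᶠ n in atTop, fk (k n) z ≤ ((fk (k n) z).toReal : EReal)) ∧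
      Tendsto (fun n => (fk (k n) z).toReal) atTop (𝓝 (f z).toReal) := by
  have h1 : Tendsto (fun n => fk (k n) z) atTop (𝓝 (f z)) := (hconv z).comp hk
  constructor
  · have := h1.eventually (gt_mem_nhds (lt_top_iff_ne_top.2 hz))
    filter_upwards [this] with n hn
    exact (aux_real (hfk _) hn.ne).le
  · exact (EReal.tendsto_toReal hz (hf.ne_bot z)).comp h1

lemma aux_gamma {f : ℝ → EReal} {fk : ℕ → ℝ → EReal}
    (hf : ProperConvex f) (hfk : ∀ k, ProperConvex (fk k))
    (hconv : ∀ a : ℝ, Tendsto (fun k => fk k a) atTop (𝓝 (f a)))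
    (hdom : ∃ a b : ℝ, a < b ∧ f a ≠ ⊤ ∧ f b ≠ ⊤)
    {k : ℕ → ℕ} (hk : Tendsto k atTop atTop) {x c : ℕ → ℝ} {X e : ℝ}
    (hx : Tendsto x atTop (𝓝 X)) (hc : Tendsto c atTop (𝓝 e))
    (h : ∀ᶠ n in atTop, fk (k n) (x n) ≤ (c n : EReal)) : f X ≤ (e : EReal) := by
  obtain ⟨z, hzx, hz⟩ : ∃ z, z ≠ X ∧ f z ≠ ⊤ := by
    obtain ⟨a, b, hab, ha, hb⟩ := hdom
    by_cases hX : a = X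
    · exact ⟨b, by rw [← hX]; exact hab.ne', hb⟩
    · exact ⟨a, hX, ha⟩
  obtain ⟨hr1, hr2⟩ := aux_fk hf hfk hconv hk hz
  have key : ∀ s : ℝ, 0 < s → s < 1 →
      f (X + s * (z - X)) ≤ (((1 - s) * e + s * (f z).toReal : ℝ) : EReal) := by
    intro s hs0 hs1
    set w := X + s * (z - X) with hw
    have hzX : z - X ≠ 0 := sub_ne_zero.2 hzx
    have hden : Tendsto (fun n => z - x n) atTop (𝓝 (z - X)) := tendsto_const_nhds.sub hx
    have hs : Tendsto (fun n => (w - x n) / (z - x n)) atTop (𝓝 s) := by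
      have := ((tendsto_const_nhds (x := w)).sub hx).div hden hzX
      have e2 : (w - X) / (z - X) = s := by rw [hw]; field_simp; ring
      rwa [e2] at this
    have h0 := hs.eventually (lt_mem_nhds hs0)
    have h1 := hs.eventually (gt_mem_nhds hs1)
    have hne := hden.eventually_ne hzX
    have hlim := ((tendsto_const_nhds (x := (1:ℝ))).sub hs).mul hc |>.add (hs.mul hr2)
    have hlim2 := (continuous_coe_real_ereal.tendsto _).comp hlim
    refine le_of_tendsto_of_tendsto ((hconv w).comp hk) hlim2 ?_
    filter_upwards [h0, h1, hne, h, hr1] with n a0 a1 an ah ar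
    have := aux_conv_s19 (hfk (k n)) ar ah a0 a1
    have e3 : (w - x n) / (z - x n) * z + (1 - (w - x n) / (z - x n)) * x n = w := by
      field_simp; ring
    rw [e3] at this
    simp only [Function.comp]
    refine this.trans (le_of_eq ?_)
    congr 1; ring
  have hs : Tendsto (fun n : ℕ => 1 / ((n : ℝ) + 1)) atTop (𝓝 0) :=
    tendsto_one_div_add_atTop_nhds_zero_nat
  have hw : Tendsto (fun n : ℕ => X + 1 / ((n : ℝ) + 1) * (z - X)) atTop (𝓝 X) := by
    simpa using (tendsto_const_nhds (x := X)).add (hs.mul_const (z - X))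
  have hd : Tendsto (fun n : ℕ => (1 - 1 / ((n : ℝ) + 1)) * e + 1 / ((n : ℝ) + 1) * (f z).toReal)
      atTop (𝓝 e) := by
    simpa using (((tendsto_const_nhds (x := (1:ℝ))).sub hs).mul_const e).add
      (hs.mul_const (f z).toReal)
  refine aux_lsc hf.lsc hw hd ?_
  filter_upwards [eventually_gt_atTop 0] with n hn
  have hn' : (0:ℝ) < n := by exact_mod_cast hn
  exact key _ (by positivity) (by rw [div_lt_one (by positivity)]; linarith)

lemma aux_fin {f : ℝ → EReal} (hf : ProperConvex f) {a b : ℝ} (h : b ∈ subdiff f a) :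
    f a ≠ ⊤ := by
  obtain ⟨z, hz⟩ := hf.proper
  intro ha
  have := h z
  rw [ha, EReal.top_add_coe] at this
  exact hz (top_le_iff.1 this)

lemma aux_sub {f : ℝ → EReal} (hf : ProperConvex f) {a b x r : ℝ} (h : b ∈ subdiff f a)
    (hr : f x ≤ (r : EReal)) : (f a).toReal + b * (x - a) ≤ r := by
  have h1 := (h x).trans hr
  rw [aux_real hf (aux_fin hf h)] at h1
  exact_mod_cast h1

lemma aux_closed {f : ℝ → EReal} (hf : ProperConvex f) {a b : ℕ → ℝ} {A B : ℝ}
    (ha : Tendsto a atTop (𝓝 A)) (hb : Tendsto b atTop (𝓝 B))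
    (h : ∀ n, b n ∈ subdiff f (a n)) : B ∈ subdiff f A := by
  intro x
  by_cases hx : f x = ⊤
  · rw [hx]; exact le_top
  have h1 : f A ≤ (((f x).toReal - B * (x - A) : ℝ) : EReal) := by
    refine aux_lsc hf.lsc ha (d := fun n => (f x).toReal - b n * (x - a n))
      (tendsto_const_nhds.sub (hb.mul (tendsto_const_nhds.sub ha))) (Eventually.of_forall ?_)
    intro n
    have := aux_sub hf (h n) (aux_real hf hx).le
    rw [aux_real hf (aux_fin hf (h n))]
    exact_mod_cast (by linarith)
  have hA : f A ≠ ⊤ := (h1.trans_lt (EReal.coe_lt_top _)).ne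
  rw [aux_real hf hA] at h1 ⊢
  rw [aux_real hf hx]
  have h2 := EReal.coe_le_coe_iff.1 h1
  exact_mod_cast (by linarith)

lemma aux_strict {f : ℝ → EReal} (hf : ProperConvex f)
    (hstrict : ∀ x ∈ interior {a : ℝ | f a ≠ ⊤}, ∀ y ∈ interior {a : ℝ | f a ≠ ⊤},
      x ≠ y → ∀ t : ℝ, 0 < t → t < 1 →
        f (t * x + (1 - t) * y) < (t : EReal) * f x + ((1 - t) : EReal) * f y)
    {a b x : ℝ} (h : b ∈ subdiff f a) (hxa : x ≠ a)
    (hx : f x ≤ (((f a).toReal + b * (x - a) : ℝ) : EReal)) : False := by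
  have key : ∀ t : ℝ, 0 < t → t < 1 →
      f (a + t * (x - a)) = (((f a).toReal + b * (t * (x - a)) : ℝ) : EReal) := by
    intro t h0 h1
    have h2 := aux_conv_s19 hf hx (aux_real hf (aux_fin hf h)).le h0 h1
    have e1 : t * x + (1 - t) * a = a + t * (x - a) := by ring
    rw [e1] at h2
    apply le_antisymm
    · refine h2.trans (le_of_eq ?_)
      congr 1; ring
    · have h3 := h (a + t * (x - a))
      rw [aux_real hf (aux_fin hf h)] at h3
      refine le_trans (le_of_eq ?_) h3
      rw [← EReal.coe_add]; congr 1; ring_nf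
  have hint : ∀ t : ℝ, 0 < t → t < 1 → a + t * (x - a) ∈ interior {a : ℝ | f a ≠ ⊤} := by
    intro t h0 h1
    have hxa' : x - a ≠ 0 := sub_ne_zero.2 hxa
    let g : ℝ → ℝ := fun w => (w - a) / (x - a)
    have hg : Continuous g := by fun_prop
    have ho : IsOpen (g ⁻¹' Set.Ioo 0 1) := isOpen_Ioo.preimage hg
    refine mem_interior.2 ⟨_, ?_, ho, ?_⟩
    · rintro w ⟨w0, w1⟩
      have h3 := key _ w0 w1
      have e : a + g w * (x - a) = w := by simp only [g]; field_simp; ring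
      rw [e] at h3
      simp only [Set.mem_ofPred_eq, h3]
      exact EReal.coe_ne_top _
    · have e : g (a + t * (x - a)) = t := by simp only [g]; field_simp; ring
      simp only [Set.mem_preimage, e]; exact ⟨h0, h1⟩
  have hs := hstrict _ (hint (1/4) (by norm_num) (by norm_num)) _
    (hint (3/4) (by norm_num) (by norm_num))
    (by intro h; apply hxa; linarith) (1/2) (by norm_num) (by norm_num)
  rw [key (1/4) (by norm_num) (by norm_num), key (3/4) (by norm_num) (by norm_num)] at hs
  have e : (1/2:ℝ) * (a + 1/4 * (x - a)) + (1 - 1/2) * (a + 3/4 * (x - a)) = a + 1/2 * (x - a) := by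
    ring
  rw [e, key (1/2) (by norm_num) (by norm_num)] at hs
  have e1 : ((1 : EReal) - ((1/2 : ℝ) : EReal)) = ((1 - 1/2 : ℝ) : EReal) := by norm_cast
  rw [e1, ← EReal.coe_mul, ← EReal.coe_mul, ← EReal.coe_add, EReal.coe_lt_coe_iff] at hs
  linarith

lemma aux_subseq {R C : ℝ} {a b : ℕ → ℝ} (ha : ∀ n, |a n| ≤ R) (hb : ∀ n, |b n| ≤ C) :
    ∃ A B : ℝ, ∃ φ : ℕ → ℕ, StrictMono φ ∧ Tendsto (a ∘ φ) atTop (𝓝 A) ∧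
      Tendsto (b ∘ φ) atTop (𝓝 B) := by
  obtain ⟨A, -, φ, hφ, hA⟩ := (isCompact_Icc (a := -R) (b := R)).tendsto_subseq
    (x := a) (fun n => abs_le.1 (ha n))
  obtain ⟨B, -, ψ, hψ, hB⟩ := (isCompact_Icc (a := -C) (b := C)).tendsto_subseq
    (x := b ∘ φ) (fun n => abs_le.1 (hb (φ n)))
  exact ⟨A, B, φ ∘ ψ, hφ.comp hψ, hA.comp hψ.tendsto_atTop, hB⟩

lemma aux_far {f : ℝ → EReal} {fk : ℕ → ℝ → EReal}
    (hf : ProperConvex f) (hfk : ∀ k, ProperConvex (fk k))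
    (hconv : ∀ a : ℝ, Tendsto (fun k => fk k a) atTop (𝓝 (f a)))
    (hdom : ∃ a b : ℝ, a < b ∧ f a ≠ ⊤ ∧ f b ≠ ⊤)
    (hstrict : ∀ x ∈ interior {a : ℝ | f a ≠ ⊤}, ∀ y ∈ interior {a : ℝ | f a ≠ ⊤},
      x ≠ y → ∀ t : ℝ, 0 < t → t < 1 →
        f (t * x + (1 - t) * y) < (t : EReal) * f x + ((1 - t) : EReal) * f y)
    (R C ε : ℝ) (hε : 0 < ε) :
    ∃ δ : ℝ, 0 < δ ∧ ∃ K : ℕ, ∀ k ≥ K, ∀ a b x r : ℝ, |a| ≤ R → |b| ≤ C →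
      b ∈ subdiff f a → ε ≤ |x - a| → fk k x ≤ (r : EReal) →
      (f a).toReal + b * (x - a) + δ ≤ r := by
  by_contra hcon
  push Not at hcon
  have hcon' := fun n : ℕ => hcon (1 / ((n : ℝ) + 1)) (by positivity) n
  choose k hk a b x r ha hb hs hxa hfr hr using hcon'
  obtain ⟨A, B, φ, hφ, hA, hB⟩ := aux_subseq ha hb
  have hAB : B ∈ subdiff f A := aux_closed hf hA hB (fun n => hs (φ n))
  have hAfin := aux_fin hf hAB
  have hkt : Tendsto (k ∘ φ) atTop atTop :=
    (tendsto_atTop_mono hk tendsto_id).comp hφ.tendsto_atTop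
  obtain ⟨hq1, hq2⟩ := aux_fk hf hfk hconv hkt hAfin
  -- truncated points
  let m : ℕ → ℝ := fun n => max 1 |x (φ n) - A|
  have hm : ∀ n, 1 ≤ m n := fun n => le_max_left _ _
  let y : ℕ → ℝ := fun n => A + (x (φ n) - A) / (2 * m n)
  have hyb : ∀ n, |y n - A| ≤ 1 := by
    intro n
    have h1 := hm n
    have h2 : |x (φ n) - A| ≤ m n := le_max_right _ _
    simp only [y, add_sub_cancel_left, abs_div]
    rw [abs_of_pos (by linarith : (0:ℝ) < 2 * m n), div_le_one (by linarith)]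
    linarith
  have hylow : ∀ᶠ n in atTop, min (ε / 4) (1 / 4) ≤ |y n - A| := by
    have h3 : ∀ᶠ n in atTop, |a (φ n) - A| < ε / 2 := by
      have := Metric.tendsto_nhds.1 hA (ε / 2) (by linarith)
      simpa [Real.dist_eq] using this
    filter_upwards [h3] with n hn
    have h4 : ε / 2 ≤ |x (φ n) - A| := by
      have h5 := hxa (φ n)
      have h6 : |x (φ n) - a (φ n)| ≤ |x (φ n) - A| + |a (φ n) - A| := by
        rw [abs_sub_comm (a (φ n)) A]; exact abs_sub_le _ _ _
      linarith
    have h1 := hm n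
    simp only [y, add_sub_cancel_left, abs_div]
    rw [abs_of_pos (by linarith : (0:ℝ) < 2 * m n), le_div_iff₀ (by linarith)]
    rcases le_total 1 |x (φ n) - A| with h | h
    · have : m n = |x (φ n) - A| := max_eq_right h
      rw [this]
      have := min_le_right (ε / 4) (1 / 4)
      nlinarith
    · have : m n = 1 := max_eq_left h
      rw [this]
      have := min_le_left (ε / 4) (1 / 4)
      linarith
  obtain ⟨Z, -, ψ, hψ, hZ⟩ := (isCompact_Icc (a := A - 1) (b := A + 1)).tendsto_subseq
    (x := y) (fun n => by
      have := abs_le.1 (hyb n)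
      constructor <;> linarith [this.1, this.2])
  have hψt := hψ.tendsto_atTop
  have hZA : Z ≠ A := by
    have h1 : min (ε / 4) (1 / 4) ≤ |Z - A| :=
      ge_of_tendsto ((hZ.sub_const A).abs) (hψt.eventually hylow)
    intro h
    rw [h, sub_self, abs_zero] at h1
    have : 0 < min (ε / 4) (1 / 4) := lt_min (by linarith) (by norm_num)
    linarith
  refine aux_strict hf hstrict hAB hZA ?_
  have hd : Tendsto (fun n => 1 / (((φ (ψ n) : ℕ) : ℝ) + 1)) atTop (𝓝 0) :=
    tendsto_one_div_add_atTop_nhds_zero_nat.comp (hφ.tendsto_atTop.comp hψt)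
  have hlim : Tendsto (fun n => max (f A).toReal ((fk (k (φ (ψ n))) A).toReal)
      + b (φ (ψ n)) * (y (ψ n) - A) + 1 / (((φ (ψ n) : ℕ) : ℝ) + 1)) atTop
      (𝓝 ((f A).toReal + B * (Z - A))) := by
    have h1 := (((tendsto_const_nhds (x := (f A).toReal)).max (hq2.comp hψt)).add
      ((hB.comp hψt).mul (hZ.sub_const A))).add hd
    simpa [Function.comp_def] using h1
  refine aux_gamma hf hfk hconv hdom (hkt.comp hψt) hZ hlim ?_
  filter_upwards [hψt.eventually hq1] with n hq
  simp only [Function.comp] at hq ⊢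
  set j := φ (ψ n) with hj
  have h1 := hm (ψ n)
  have hsub := aux_sub hf (hs j) (aux_real hf hAfin).le
  have ht0 : 0 < 1 / (2 * m (ψ n)) := by positivity
  have ht1 : 1 / (2 * m (ψ n)) < 1 := by rw [div_lt_one (by linarith)]; linarith
  set t := 1 / (2 * m (ψ n)) with ht
  have hc := aux_conv_s19 (hfk (k j)) (hfr j) hq ht0 ht1
  have hyt : y (ψ n) = t * x j + (1 - t) * A := by
    simp only [y, ht, ← hj]; ring
  rw [hyt]
  refine hc.trans ?_
  rw [EReal.coe_le_coe_iff]
  have hrr := hr j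
  have hM1 := le_max_left (f A).toReal ((fk (k j) A).toReal)
  have hM2 := le_max_right (f A).toReal ((fk (k j) A).toReal)
  set M := max (f A).toReal ((fk (k j) A).toReal)
  set d := 1 / ((j : ℝ) + 1)
  have hd0 : 0 < d := by positivity
  have h5 : r j ≤ M + b j * (x j - A) + d := by nlinarith
  have h6 : t * r j ≤ t * (M + b j * (x j - A) + d) := mul_le_mul_of_nonneg_left h5 ht0.le
  have h7 : (1 - t) * (fk (k j) A).toReal ≤ (1 - t) * M :=
    mul_le_mul_of_nonneg_left hM2 (by linarith)
  have h8 : t * d ≤ d := by nlinarith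
  nlinarith

lemma aux_near {f : ℝ → EReal} {fk : ℕ → ℝ → EReal}
    (hf : ProperConvex f) (hfk : ∀ k, ProperConvex (fk k))
    (hconv : ∀ a : ℝ, Tendsto (fun k => fk k a) atTop (𝓝 (f a)))
    (hdom : ∃ a b : ℝ, a < b ∧ f a ≠ ⊤ ∧ f b ≠ ⊤)
    (R C ε η : ℝ) (hη : 0 < η) :
    ∃ K : ℕ, ∀ k ≥ K, ∀ a b x r : ℝ, |a| ≤ R → |b| ≤ C →
      b ∈ subdiff f a → |x - a| ≤ ε → fk k x ≤ (r : EReal) →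
      (f a).toReal + b * (x - a) - η ≤ r := by
  by_contra hcon
  push Not at hcon
  choose k hk a b x r ha hb hs hxa hfr hr using hcon
  obtain ⟨A, B, φ, hφ, hA, hB⟩ := aux_subseq ha hb
  have hAB : B ∈ subdiff f A := aux_closed hf hA hB (fun n => hs (φ n))
  have hAfin := aux_fin hf hAB
  have hkt : Tendsto (k ∘ φ) atTop atTop :=
    (tendsto_atTop_mono hk tendsto_id).comp hφ.tendsto_atTop
  obtain ⟨Z, -, ψ, hψ, hZ⟩ := (isCompact_Icc (a := -(R + ε)) (b := R + ε)).tendsto_subseq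
    (x := x ∘ φ) (fun n => by
      have h1 := abs_le.1 (hxa (φ n))
      have h2 := abs_le.1 (ha (φ n))
      simp only [Function.comp]
      constructor <;> linarith [h1.1, h2.1, h1.2, h2.2])
  have hψt := hψ.tendsto_atTop
  have hlim : Tendsto (fun n => (f A).toReal + b (φ (ψ n)) * (x (φ (ψ n)) - A) - η) atTop
      (𝓝 ((f A).toReal + B * (Z - A) - η)) :=
    ((tendsto_const_nhds).add ((hB.comp hψt).mul (hZ.sub_const A))).sub_const η
  have h1 := aux_gamma hf hfk hconv hdom (hkt.comp hψt) hZ hlim (Eventually.of_forall (by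
    intro n
    simp only [Function.comp]
    set j := φ (ψ n)
    refine (hfr j).trans ?_
    rw [EReal.coe_le_coe_iff]
    have hsub := aux_sub hf (hs j) (aux_real hf hAfin).le
    have := hr j
    nlinarith))
  have h2 := aux_sub hf hAB h1
  linarith

/-- From the weak convergence of `u_k` and of `f_k(u_k)` to `f(u)`, with `f` strictly convex
on the interior of its domain, the convergence of `u_k` to `u` locally in measure. -/
theorem statement19 (d : ℕ)
    (f : ℝ → EReal) (fk : ℕ → ℝ → EReal)
    (hf : ProperConvex f) (hfk : ∀ k, ProperConvex (fk k))
    (hconv : ∀ a : ℝ, Tendsto (fun k => fk k a) atTop (𝓝 (f a)))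
    (hdom : ∃ a b : ℝ, a < b ∧ f a ≠ ⊤ ∧ f b ≠ ⊤)
    (hstrict : ∀ x ∈ interior {a : ℝ | f a ≠ ⊤}, ∀ y ∈ interior {a : ℝ | f a ≠ ⊤},
      x ≠ y → ∀ t : ℝ, 0 < t → t < 1 →
        f (t * x + (1 - t) * y) < (t : EReal) * f x + ((1 - t) : EReal) * f y)
    (u : ℕ → ℝ × (Fin d → ℝ) → ℝ) (ulim : ℝ × (Fin d → ℝ) → ℝ)
    (hu_meas : ∀ k, Measurable (u k)) (hulim_meas : Measurable ulim)
    (hu_loc : ∀ k, ∀ D : Set (ℝ × (Fin d → ℝ)), IsCompact D → D ⊆ Qinf d →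
        IntegrableOn (u k) D)
    (hulim_loc : ∀ D : Set (ℝ × (Fin d → ℝ)), IsCompact D → D ⊆ Qinf d →
        IntegrableOn ulim D)
    (hu_ui : ∀ D : Set (ℝ × (Fin d → ℝ)), IsCompact D → D ⊆ Qinf d →
        ∀ ε : ℝ, 0 < ε → ∃ δ : ℝ, 0 < δ ∧
          ∀ A : Set (ℝ × (Fin d → ℝ)), MeasurableSet A → A ⊆ D →
            volume A < ENNReal.ofReal δ → ∀ k, (∫ p in A, |u k p|) ≤ ε)
    (hu_weak : WeakL1LocTendsto d u ulim)
    (hfu_loc : ∀ k, ∀ D : Set (ℝ × (Fin d → ℝ)), IsCompact D → D ⊆ Qinf d →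
        (∀ᵐ p ∂(volume.restrict D), fk k (u k p) ≠ ⊤) ∧
        IntegrableOn (fun p => (fk k (u k p)).toReal) D)
    (hfu_weak : WeakL1LocTendsto d (fun k p => (fk k (u k p)).toReal)
        (fun p => (f (ulim p)).toReal))
    (hflim_int : ∀ T : ℝ, 0 < T →
        (∀ᵐ p ∂(volume.restrict (QT d T)), f (ulim p) ≠ ⊤) ∧
        IntegrableOn (fun p => (f (ulim p)).toReal) (QT d T))
    (v : ℝ × (Fin d → ℝ) → ℝ) (hv_meas : Measurable v)
    (hv_bdd : ∀ D : Set (ℝ × (Fin d → ℝ)), IsCompact D → D ⊆ Qinf d →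
        ∃ C : ℝ, ∀ᵐ p ∂(volume.restrict D), |v p| ≤ C)
    (hv_sub : ∀ᵐ p ∂(volume.restrict (Qinf d)), v p ∈ subdiff f (ulim p)) :
    ∀ D : Set (ℝ × (Fin d → ℝ)), IsCompact D → D ⊆ Qinf d →
      ∀ ε : ℝ, 0 < ε →
        Tendsto (fun k => volume {p : ℝ × (Fin d → ℝ) | p ∈ D ∧ ε < |u k p - ulim p|})
          atTop (𝓝 0) := by
  intro D hD hDQ ε hε
  have hDm : MeasurableSet D := hD.measurableSet
  have hDfin : volume D ≠ ⊤ := hD.measure_lt_top.ne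
  obtain ⟨C, hC⟩ := hv_bdd D hD hDQ
  have hv_subD : ∀ᵐ p ∂(volume.restrict D), v p ∈ subdiff f (ulim p) :=
    ae_mono (Measure.restrict_mono hDQ le_rfl) hv_sub
  have hFint : IntegrableOn (fun p => (f (ulim p)).toReal) D := by
    obtain ⟨T, hT⟩ := (hD.image continuous_fst).bddAbove
    refine (hflim_int (max T 1) (by positivity)).2.mono_set ?_
    intro p hp
    refine ⟨⟨hDQ hp, le_max_of_le_left (hT ⟨p, hp, rfl⟩)⟩, Set.mem_univ _⟩
  -- the exceptional set
  have htail : Tendsto (fun n : ℕ => volume (D ∩ {p | (n : ℝ) < |ulim p|})) atTop (𝓝 0) := by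
    have h := tendsto_measure_iInter_atTop (μ := (volume : Measure (ℝ × (Fin d → ℝ))))
      (s := fun n : ℕ => D ∩ {p | (n : ℝ) < |ulim p|})
      (fun n => (hDm.inter (measurableSet_lt measurable_const hulim_meas.abs)).nullMeasurableSet)
      (by
        intro m n hmn p hp
        have h1 : (n : ℝ) < |ulim p| := hp.2
        have h2 : (m : ℝ) ≤ n := by exact_mod_cast hmn
        exact ⟨hp.1, show (m : ℝ) < |ulim p| from lt_of_le_of_lt h2 h1⟩)
      ⟨0, ((measure_mono Set.inter_subset_left).trans_lt hD.measure_lt_top).ne⟩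
    have he : (⋂ n : ℕ, D ∩ {p | (n : ℝ) < |ulim p|}) = ∅ := by
      rw [Set.eq_empty_iff_forall_notMem]
      intro p hp
      obtain ⟨n, hn⟩ := exists_nat_gt |ulim p|
      have := (Set.mem_iInter.1 hp n).2
      exact absurd hn (not_lt.2 (le_of_lt this))
    rw [he, measure_empty] at h
    exact h
  rw [ENNReal.tendsto_nhds_zero]
  intro τ' hτ'
  obtain ⟨τ, hτ0, hττ⟩ : ∃ τ : ℝ, 0 < τ ∧ ENNReal.ofReal τ + ENNReal.ofReal τ ≤ τ' := by
    obtain ⟨q, hq0, hq⟩ := ENNReal.lt_iff_exists_nnreal_btwn.1 hτ'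
    refine ⟨(q : ℝ) / 2, by have : 0 < q := by exact_mod_cast hq0
                            positivity, ?_⟩
    rw [← ENNReal.ofReal_add (by positivity) (by positivity), add_halves]
    simpa using hq.le
  obtain ⟨N, hN⟩ := (ENNReal.tendsto_nhds_zero.1 htail (ENNReal.ofReal τ) (by simpa using hτ0)).exists
  obtain ⟨δ, hδ, K1, hK1⟩ := aux_far hf hfk hconv hdom hstrict N C ε hε
  set V : ℝ := volume.real D with hV
  have hV0 : 0 ≤ V := measureReal_nonneg
  obtain ⟨η, hη, hηV⟩ : ∃ η : ℝ, 0 < η ∧ η * V ≤ δ * τ / 2 := by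
    refine ⟨δ * τ / 2 / (V + 1), by positivity, ?_⟩
    rw [div_mul_eq_mul_div, div_le_iff₀ (by positivity)]
    have : 0 < δ * τ / 2 := by positivity
    nlinarith
  obtain ⟨K2, hK2⟩ := aux_near hf hfk hconv hdom N C ε η hη
  set D' : Set (ℝ × (Fin d → ℝ)) := D ∩ {p | |ulim p| ≤ N ∧ |v p| ≤ C} with hD'
  have hD'm : MeasurableSet D' := hDm.inter
    ((measurableSet_le hulim_meas.abs measurable_const).inter
      (measurableSet_le hv_meas.abs measurable_const))
  have hD'D : D' ⊆ D := Set.inter_subset_left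
  have hD'fin : volume D' ≠ ⊤ := ((measure_mono hD'D).trans_lt hD.measure_lt_top).ne
  let F : ℝ × (Fin d → ℝ) → ℝ := fun p => (f (ulim p)).toReal
  let Fk : ℕ → ℝ × (Fin d → ℝ) → ℝ := fun k p => (fk k (u k p)).toReal
  have conv : ∀ g : ℝ × (Fin d → ℝ) → ℝ, ∀ w : ℝ × (Fin d → ℝ) → ℝ,
      ∫ p in Qinf d, D'.indicator g p * w p = ∫ p in D', g p * w p := by
    intro g w
    have : (fun p => D'.indicator g p * w p) = D'.indicator (fun p => g p * w p) := by
      ext p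
      by_cases hp : p ∈ D' <;> simp [hp]
    rw [this, setIntegral_indicator hD'm, Set.inter_eq_right.2 (hD'D.trans hDQ)]
  have hw1 := hfu_weak D hD hDQ (D'.indicator (fun _ => 1)) (measurable_const.indicator hD'm)
    ⟨1, fun p => by by_cases hp : p ∈ D' <;> simp [hp]⟩
    (fun p hp => Set.indicator_of_notMem (fun h => hp (hD'D h)) _)
  have hw2 := hu_weak D hD hDQ (D'.indicator v) (hv_meas.indicator hD'm)
    ⟨max C 0, fun p => by
      by_cases hp : p ∈ D'
      · simpa [hp] using Or.inl hp.2.2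
      · simp [hp]⟩
    (fun p hp => Set.indicator_of_notMem (fun h => hp (hD'D h)) _)
  simp only [conv, one_mul] at hw1 hw2
  have hiF : IntegrableOn F D' := hFint.mono_set hD'D
  have hiFk : ∀ k, IntegrableOn (Fk k) D' := fun k => (hfu_loc k D hD hDQ).2.mono_set hD'D
  have hvb : ∀ᵐ p ∂(volume.restrict D'), ‖v p‖ ≤ C := by
    refine (ae_restrict_iff' hD'm).2 (Eventually.of_forall fun p hp => hp.2.2)
  have hiu : IntegrableOn (fun p => v p * ulim p) D' :=
    ((hulim_loc D hD hDQ).mono_set hD'D).bdd_mul hv_meas.aestronglyMeasurable hvb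
  have hiuk : ∀ k, IntegrableOn (fun p => v p * u k p) D' := fun k =>
    ((hu_loc k D hD hDQ).mono_set hD'D).bdd_mul hv_meas.aestronglyMeasurable hvb
  let g : ℕ → ℝ × (Fin d → ℝ) → ℝ := fun k p => (Fk k p - F p) - (v p * u k p - v p * ulim p) + η
  have hgi : ∀ k, IntegrableOn (g k) D' := fun k =>
    (((hiFk k).sub hiF).sub ((hiuk k).sub hiu)).add (integrableOn_const hD'fin)
  have hgint : ∀ k, ∫ p in D', g k p = ((∫ p in D', Fk k p) - ∫ p in D', F p)
      - ((∫ p in D', v p * u k p) - ∫ p in D', v p * ulim p) + η * volume.real D' := by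
    intro k
    have h1 := integral_add (((hiFk k).sub hiF).sub ((hiuk k).sub hiu))
      (integrableOn_const (μ := volume) (s := D') (C := η) hD'fin)
    have h2 := integral_sub ((hiFk k).sub hiF) ((hiuk k).sub hiu)
    have h3 := integral_sub (hiFk k) hiF
    have h4 := integral_sub (hiuk k) hiu
    simp only [Pi.sub_apply] at h1 h2 h3 h4
    simp only [g]
    rw [h1, h2, h3, h4, setIntegral_const, smul_eq_mul, mul_comm (volume.real D')]
  have hlim : Tendsto (fun k => ∫ p in D', g k p) atTop (𝓝 (η * volume.real D')) := by
    simp only [hgint]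
    have := ((hw1.sub_const (∫ p in D', F p)).sub
      (hw2.sub_const (∫ p in D', v p * ulim p))).add_const (η * volume.real D')
    simpa [F, Fk] using this
  have hlt : η * volume.real D' < δ * τ := by
    have h1 : volume.real D' ≤ V := measureReal_mono hD'D hDfin
    have h2 : η * volume.real D' ≤ η * V := mul_le_mul_of_nonneg_left h1 hη.le
    have : 0 < δ * τ := by positivity
    linarith
  filter_upwards [hlim.eventually (gt_mem_nhds hlt), eventually_ge_atTop K1,
    eventually_ge_atTop K2] with k hk hkK1 hkK2
  have hae : ∀ᵐ p ∂(volume.restrict D'), 0 ≤ g k p ∧ (ε < |u k p - ulim p| → δ ≤ g k p) := by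
    have h1 := ae_mono (Measure.restrict_mono hD'D le_rfl) (hfu_loc k D hD hDQ).1
    have h2 := ae_mono (Measure.restrict_mono hD'D le_rfl) hv_subD
    filter_upwards [h1, h2, ae_restrict_mem hD'm] with p p1 p2 p3
    have p4 := (aux_real (hfk k) p1).le
    have far : ε ≤ |u k p - ulim p| → δ ≤ g k p := by
      intro h
      have := hK1 k hkK1 _ _ _ _ p3.2.1 p3.2.2 p2 h p4
      simp only [g, F, Fk]; linarith
    refine ⟨?_, fun h => far h.le⟩
    rcases le_total ε |u k p - ulim p| with h | h
    · exact hδ.le.trans (far h)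
    · have := hK2 k hkK2 _ _ _ _ p3.2.1 p3.2.2 p2 h p4
      simp only [g, F, Fk]; linarith
  have hmark := mul_meas_ge_le_integral_of_nonneg (μ := volume.restrict D')
    (hae.mono fun p hp => hp.1) (hgi k) δ
  have hmark2 : (volume.restrict D').real {p | δ ≤ g k p} ≤ τ := by
    have h1 : δ * (volume.restrict D').real {p | δ ≤ g k p} < δ * τ := lt_of_le_of_lt hmark hk
    exact (lt_of_mul_lt_mul_left h1 hδ.le).le
  have : IsFiniteMeasure (volume.restrict D') := ⟨by
    rw [Measure.restrict_apply_univ]; exact lt_top_iff_ne_top.2 hD'fin⟩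
  have hmark3 : (volume.restrict D') {p | δ ≤ g k p} ≤ ENNReal.ofReal τ := by
    rw [← ENNReal.ofReal_toReal (measure_ne_top (volume.restrict D') {p | δ ≤ g k p})]
    exact ENNReal.ofReal_le_ofReal hmark2
  have hE : volume (D' ∩ {p | ε < |u k p - ulim p|}) ≤ ENNReal.ofReal τ := by
    have hm : MeasurableSet {p | ε < |u k p - ulim p|} :=
      measurableSet_lt measurable_const ((hu_meas k).sub hulim_meas).abs
    rw [Set.inter_comm, ← Measure.restrict_apply hm]
    refine le_trans (measure_mono_ae ?_) hmark3
    filter_upwards [hae] with p hp h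
    exact hp.2 h
  have hZ : volume (D ∩ {p | ¬ |v p| ≤ C}) = 0 := by
    have hm : MeasurableSet {p | ¬ |v p| ≤ C} :=
      (measurableSet_le hv_meas.abs measurable_const).compl
    rw [Set.inter_comm, ← Measure.restrict_apply hm]
    exact hC
  calc volume {p : ℝ × (Fin d → ℝ) | p ∈ D ∧ ε < |u k p - ulim p|}
      ≤ volume ((D' ∩ {p | ε < |u k p - ulim p|}) ∪ (D ∩ {p | (N : ℝ) < |ulim p|})
          ∪ (D ∩ {p | ¬ |v p| ≤ C})) := by
        refine measure_mono ?_
        rintro p ⟨hp, hpe⟩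
        by_cases h1 : |v p| ≤ C
        · by_cases h2 : |ulim p| ≤ N
          · exact Or.inl (Or.inl ⟨⟨hp, h2, h1⟩, hpe⟩)
          · exact Or.inl (Or.inr ⟨hp, not_le.1 h2⟩)
        · exact Or.inr ⟨hp, h1⟩
    _ ≤ volume ((D' ∩ {p | ε < |u k p - ulim p|}) ∪ (D ∩ {p | (N : ℝ) < |ulim p|}))
          + volume (D ∩ {p | ¬ |v p| ≤ C}) := measure_union_le _ _
    _ ≤ (ENNReal.ofReal τ + ENNReal.ofReal τ) + 0 :=
        add_le_add ((measure_union_le _ _).trans (add_le_add hE hN)) hZ.le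
    _ ≤ τ' := by simpa using hττ
end
end
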